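/- Let N ≥ 1, k ≥ 1, let f be a modular form of weight k on Γ(N), and let A be a subring of ℂ containing all Fourier coefficients a_n(f), n ≥ 0. Then for every g ∈ SL₂(ℤ), all Fourier coefficients of f|_k g lie in the subring of ℂ generated by A together with ζ_N and 1/N. -/

import Mathlib

open Complex UpperHalfPlane CongruenceSubgroup
open scoped ModularForm MatrixGroups Real

noncomputable section

/-- `ζ_N = e^{2πi/N}`. -/
def zetaC (N : ℕ) : ℂ := Complex.exp (2 * Real.pi * Complex.I / N)

/-- `f` has the Fourier expansion `Σ_{n ≥ 0} c n · e^{2πinτ/N}`. -/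
def HasExpansion (N : ℕ) (f : ℍ → ℂ) (c : ℕ → ℂ) : Prop :=
  ∀ τ : ℍ, HasSum (fun n : ℕ => c n * Complex.exp (2 * Real.pi * Complex.I * n * (τ : ℂ) / N)) (f τ)

namespace QP

open PowerSeries (coeff)
open scoped Manifold

def qn (N : ℕ) (τ : ℍ) : ℂ := Complex.exp (2 * Real.pi * Complex.I * (τ : ℂ) / N)

lemma qn_eq (N : ℕ) (τ : ℍ) : qn N τ = Function.Periodic.qParam N τ := by
  simp [qn, Function.Periodic.qParam]

lemma qn_ne (N : ℕ) (τ : ℍ) : qn N τ ≠ 0 := Complex.exp_ne_zero _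

lemma qn_lt {N : ℕ} (hN : 1 ≤ N) (τ : ℍ) : ‖qn N τ‖ < 1 := by
  rw [qn_eq]; exact Function.Periodic.norm_qParam_lt_one (by exact_mod_cast hN) τ.im_pos

def HX (N : ℕ) (f : ℍ → ℂ) (p : PowerSeries ℂ) : Prop :=
  ∀ τ, HasSum (fun n => coeff n p * qn N τ ^ n) (f τ)

lemma HX_iff {N : ℕ} {f : ℍ → ℂ} {c : ℕ → ℂ} :
    HasExpansion N f c ↔ HX N f (PowerSeries.mk c) := by
  unfold HasExpansion HX qn
  refine forall_congr' fun τ => ?_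
  simp only [PowerSeries.coeff_mk, ← Complex.exp_nat_mul]
  have : ∀ n : ℕ, (2 * Real.pi * Complex.I * n * (τ : ℂ) / N) =
    n * (2 * Real.pi * Complex.I * (τ : ℂ) / N) := fun n => by ring
  simp only [this]

variable {N : ℕ} {f g : ℍ → ℂ} {p r : PowerSeries ℂ}

lemma HX.add (hf : HX N f p) (hg : HX N g r) : HX N (f + g) (p + r) := fun τ => by
  simpa [add_mul] using (hf τ).add (hg τ)

lemma HX.smul (c : ℂ) (hf : HX N f p) : HX N (c • f) (c • p) := fun τ => by
  simpa [mul_assoc] using (hf τ).mul_left c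

lemma HX.neg (hf : HX N f p) : HX N (-f) (-p) := fun τ => by
  simpa using (hf τ).neg

lemma HX.sub (hf : HX N f p) (hg : HX N g r) : HX N (f - g) (p - r) := fun τ => by
  simpa [sub_mul] using (hf τ).sub (hg τ)

lemma HX.zero : HX N 0 0 := fun τ => by simp [hasSum_zero]

lemma HX.const (c : ℂ) : HX N (fun _ => c) (PowerSeries.C c) := fun τ => by
  convert hasSum_ite_eq 0 c using 2 with n
  rw [PowerSeries.coeff_C]
  split_ifs with h <;> simp [h]

lemma HX.one : HX N 1 1 := by simpa using! (HX.const (N := N) 1)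

lemma HX.sum {ι : Type*} (s : Finset ι) {f : ι → ℍ → ℂ} {p : ι → PowerSeries ℂ}
    (h : ∀ i ∈ s, HX N (f i) (p i)) : HX N (∑ i ∈ s, f i) (∑ i ∈ s, p i) := fun τ => by
  simpa [Finset.sum_mul] using hasSum_sum (fun i hi => h i hi τ)

lemma HX.mul (hf : HX N f p) (hg : HX N g r) : HX N (f * g) (p * r) := fun τ => by
  have h1 := hf τ
  have h2 := hg τ
  have h3 := tsum_mul_tsum_eq_tsum_sum_antidiagonal_of_summable_norm h1.summable.norm h2.summable.norm
  have h4 := (summable_norm_sum_mul_antidiagonal_of_summable_norm h1.summable.norm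
    h2.summable.norm).of_norm.hasSum
  rw [← h3, h1.tsum_eq, h2.tsum_eq] at h4
  refine h4.congr_fun fun n => ?_
  rw [PowerSeries.coeff_mul, Finset.sum_mul]
  refine Finset.sum_congr rfl fun x hx => ?_
  rw [← Finset.HasAntidiagonal.mem_antidiagonal.mp hx, pow_add]
  ring

lemma HX.pow (hf : HX N f p) (n : ℕ) : HX N (f ^ n) (p ^ n) := by
  induction n with
  | zero => simpa using HX.one
  | succ n ih => rw [pow_succ, pow_succ]; exact ih.mul hf

lemma HX.prod {ι : Type*} (s : Finset ι) {f : ι → ℍ → ℂ} {p : ι → PowerSeries ℂ}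
    (h : ∀ i ∈ s, HX N (f i) (p i)) : HX N (∏ i ∈ s, f i) (∏ i ∈ s, p i) := by
  classical
  induction s using Finset.induction_on with
  | empty => simpa using HX.one
  | insert a s ha ih =>
    rw [Finset.prod_insert ha, Finset.prod_insert ha]
    exact (h a (by simp)).mul (ih fun i hi => h i (by simp [hi]))

lemma HX.bdd (hN : 1 ≤ N) (hf : HX N f p) : IsBoundedAtImInfty f :=
  isBoundedAtImInfty_of_hasSum_qExpansion (h := N) (c := fun n => coeff n p) (by exact_mod_cast hN)
    (fun τ => by simpa [← qn_eq] using hf τ)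

lemma exists_qn (hN : 1 ≤ N) {z : ℂ} (hz : ‖z‖ < 1) (h0 : z ≠ 0) : ∃ τ, qn N τ = z := by
  have hh : (0 : ℝ) < N := by exact_mod_cast hN
  have h1 := Function.Periodic.im_invQParam_pos_of_norm_lt_one hh hz h0
  refine ⟨⟨Function.Periodic.invQParam N z, h1⟩, ?_⟩
  rw [qn_eq]
  exact Function.Periodic.qParam_right_inv hh.ne' h0

def pf (p : PowerSeries ℂ) (z : ℂ) : ℂ := ∑' n, coeff n p * z ^ n

lemma HX.hasSum_pf (hN : 1 ≤ N) (hf : HX N f p) {z : ℂ} (hz : ‖z‖ < 1) :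
    HasSum (fun n => coeff n p * z ^ n) (pf p z) := by
  refine Summable.hasSum ?_
  rcases eq_or_ne z 0 with rfl | h0
  · refine summable_of_ne_finset_zero (s := {0}) fun n hn => ?_
    have : n ≠ 0 := by simpa using hn
    simp [this]
  · obtain ⟨τ, rfl⟩ := exists_qn hN hz h0
    exact (hf τ).summable

lemma HX.eq_pf (hf : HX N f p) (τ : ℍ) : f τ = pf p (qn N τ) := (hf τ).tsum_eq.symm

lemma HX.fps (hN : 1 ≤ N) (hf : HX N f p) :
    HasFPowerSeriesOnBall (pf p) (.ofScalars ℂ fun n => coeff n p) 0 1 := by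
  constructor
  · refine le_of_forall_lt_imp_le_of_dense fun r hr ↦ ?_
    lift r to NNReal using hr.ne_top
    apply FormalMultilinearSeries.le_radius_of_summable
    simpa [norm_mul, mul_comm, mul_left_comm, mul_assoc] using
      (hf.hasSum_pf hN (z := r) (by simpa using hr)).summable.norm
  · simp
  · intro y hy
    rw [← ENNReal.coe_one, Metric.eball_coe, NNReal.coe_one, mem_ball_zero_iff] at hy
    simpa [mul_comm] using hf.hasSum_pf hN hy

lemma HX.unique (hN : 1 ≤ N) (hf : HX N f p) (hg : HX N f r) : p = r := by
  have h1 := (hf.fps hN).hasFPowerSeriesAt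
  have h2 := (hg.fps hN).hasFPowerSeriesAt
  have h3 : ∀ z : ℂ, ‖z‖ < 1 → z ≠ 0 → pf p z = pf r z := by
    intro z hz h0
    obtain ⟨τ, rfl⟩ := exists_qn hN hz h0
    rw [← hf.eq_pf, ← hg.eq_pf]
  have h4 : pf p =ᶠ[nhds 0] pf r := by
    have c1 := (hf.fps hN).analyticAt.continuousAt
    have c2 := (hg.fps hN).analyticAt.continuousAt
    have : pf p =ᶠ[nhdsWithin 0 {0}ᶜ] pf r := by
      filter_upwards [self_mem_nhdsWithin, mem_nhdsWithin_of_mem_nhds (Metric.ball_mem_nhds (0:ℂ) one_pos)]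
        with z h0 hz
      exact h3 z (by simpa using hz) h0
    exact (ContinuousAt.eventuallyEq_nhds_iff_eventuallyEq_nhdsNE c1 c2).mp this
  have h5 := h1.eq_formalMultilinearSeries (h2.congr h4.symm)
  ext n
  have := congrArg (fun s => s.coeff n) h5
  simpa using this

lemma HX.mdiff (hN : 1 ≤ N) (hf : HX N f p) : MDiff f := by
  rw [UpperHalfPlane.mdifferentiable_iff]
  have h1 : DifferentiableOn ℂ (pf p) (Metric.eball 0 1) := (hf.fps hN).differentiableOn
  have h2 : DifferentiableOn ℂ (fun z : ℂ => pf p (Complex.exp (2 * Real.pi * Complex.I * z / N)))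
      {z : ℂ | 0 < z.im} := by
    refine h1.comp (t := Metric.eball 0 1) (by fun_prop) ?_
    intro z hz
    have := qn_lt hN ⟨z, hz⟩
    simp only [Metric.mem_eball, edist_zero_right]
    rw [← ofReal_norm, ← ENNReal.ofReal_one, ENNReal.ofReal_lt_ofReal_iff one_pos]
    exact this
  refine h2.congr fun z hz => ?_
  simp only [Function.comp]
  rw [UpperHalfPlane.ofComplex_apply_of_im_pos hz, hf.eq_pf]
  rfl

/-- fibrewise expansions -/
lemma HX_of_fiber {ι : Type*} (a : ι → ℂ) (e : ι → ℕ)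
    (h : ∀ τ, HasSum (fun i => a i * qn N τ ^ e i) (f τ)) :
    HX N f (PowerSeries.mk fun n => ∑' i : e ⁻¹' {n}, a i) := fun τ => by
  refine ((h τ).tsum_fiberwise e).congr_fun fun n => ?_
  rw [PowerSeries.coeff_mk, ← tsum_mul_right]
  refine tsum_congr fun i => ?_
  have : e i = n := i.2
  rw [this]

end QP

namespace QP
open PowerSeries (coeff)
open scoped Manifold
open EisensteinSeries

def Inv1 (k : ℤ) (F : ℍ → ℂ) : Prop := ∀ g : SL(2, ℤ), F ∣[k] g = F

lemma Inv1.mul {k l : ℤ} {F G : ℍ → ℂ} (hF : Inv1 k F) (hG : Inv1 l G) : Inv1 (k + l) (F * G) :=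
  fun g => by rw [ModularForm.mul_slash_SL2, hF g, hG g]

lemma toMF {N : ℕ} (hN : 1 ≤ N) {k : ℤ} {F : ℍ → ℂ} {p} (hF : Inv1 k F) (hp : HX N F p) :
    ∃ M : ModularForm 𝒮ℒ k, ⇑M = F :=
  ⟨{ toFun := F
     slash_action_eq' := by
       intro γ hγ
       obtain ⟨g, rfl⟩ := hγ
       exact hF g
     holo' := hp.mdiff hN
     bdd_at_cusps' := by
       intro c hc
       rw [OnePoint.isBoundedAt_iff_forall_SL2Z hc]
       intro γ _
       rw [hF γ]
       exact hp.bdd hN }, rfl⟩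

lemma HX_MF {k : ℤ} (M : ModularForm 𝒮ℒ k) : HX 1 M (qExpansion 1 M) := fun τ => by
  have := ModularForm.hasSum_qExpansion M one_pos one_mem_strictPeriods_SL τ
  simpa [qn_eq] using this

lemma Inv1_MF {k : ℤ} (M : ModularForm 𝒮ℒ k) : Inv1 k M := fun g => by
  exact M.slash_action_eq' _ ⟨g, rfl⟩

def SZ (k : ℕ) : PowerSeries ℤ := PowerSeries.mk fun n => (ArithmeticFunction.sigma k n : ℤ)

abbrev toC : PowerSeries ℤ →+* PowerSeries ℂ := PowerSeries.map (Int.castRingHom ℂ)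

def E4Z : PowerSeries ℤ := 1 + 240 * SZ 3
def E6Z : PowerSeries ℤ := 1 - 504 * SZ 5

lemma coeff_num (m : ℕ) [m.AtLeastTwo] (p : PowerSeries ℤ) (n : ℕ) :
    coeff n ((ofNat(m) : PowerSeries ℤ) * p) = ofNat(m) * coeff n p := by
  have : (ofNat(m) : PowerSeries ℤ) = PowerSeries.C (ofNat(m) : ℤ) := by simp
  rw [this, PowerSeries.coeff_C_mul]

lemma E4Z_coeff (n : ℕ) : coeff n E4Z = (if n = 0 then 1 else 0) + 240 * (ArithmeticFunction.sigma 3 n : ℤ) := by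
  rw [E4Z, map_add, coeff_num, PowerSeries.coeff_one, SZ, PowerSeries.coeff_mk]
lemma E6Z_coeff (n : ℕ) : coeff n E6Z = (if n = 0 then 1 else 0) - 504 * (ArithmeticFunction.sigma 5 n : ℤ) := by
  rw [E6Z, map_sub, coeff_num, PowerSeries.coeff_one, SZ, PowerSeries.coeff_mk]

def E4 : ℍ → ℂ := ModularForm.E₄
def E6 : ℍ → ℂ := ModularForm.E₆
def Dl : ℍ → ℂ := ModularForm.discriminant

lemma E4_HX1 : HX 1 E4 (toC E4Z) := by
  have := HX_MF ModularForm.E₄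
  convert! this using 1
  ext n
  rcases eq_or_ne n 0 with rfl | hn
  · rw [E_qExpansion_coeff_zero _ ⟨2, rfl⟩]
    simp only [PowerSeries.coeff_map, E4Z_coeff]
    simp
  · rw [E_qExpansion_coeff _ ⟨2, rfl⟩]
    simp only [PowerSeries.coeff_map]
    norm_num [hn, show bernoulli 4 = -1 / 30 by decide +kernel, E4Z_coeff]

lemma E6_HX1 : HX 1 E6 (toC E6Z) := by
  have := HX_MF ModularForm.E₆
  convert! this using 1
  ext n
  rcases eq_or_ne n 0 with rfl | hn
  · rw [E_qExpansion_coeff_zero _ ⟨3, rfl⟩]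
    simp only [PowerSeries.coeff_map, E6Z_coeff]
    simp
  · rw [E_qExpansion_coeff _ ⟨3, rfl⟩]
    simp only [PowerSeries.coeff_map]
    norm_num [hn, show bernoulli 6 = 1 / 42 by decide +kernel, E6Z_coeff]

lemma exists_DZ : ∃ D : PowerSeries ℤ, 1728 * D = E4Z ^ 3 - E6Z ^ 2 := by
  have h : ∀ n : ℕ, (12 : ℤ) ∣ 5 * (ArithmeticFunction.sigma 3 n : ℤ) + 7 * (ArithmeticFunction.sigma 5 n : ℤ) := by
    intro n
    rw [ArithmeticFunction.sigma_apply, ArithmeticFunction.sigma_apply]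
    push_cast
    rw [Finset.mul_sum, Finset.mul_sum, ← Finset.sum_add_distrib]
    refine Finset.dvd_sum fun d _ => ?_
    have h2 : ((5 * (d:ℤ) ^ 3 + 7 * (d:ℤ) ^ 5 : ℤ) : ZMod 12) = 0 := by
      push_cast
      generalize ((d : ZMod 12)) = x
      revert x; decide
    exact (ZMod.intCast_zmod_eq_zero_iff_dvd _ 12).mp h2 |> fun h => by exact_mod_cast h
  choose c hc using h
  have hc' : 5 * SZ 3 + 7 * SZ 5 = 12 * PowerSeries.mk c := by
    ext n
    simp only [map_add, coeff_num]
    simp [SZ, hc]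
  refine ⟨PowerSeries.mk c + 100 * SZ 3 ^ 2 + 8000 * SZ 3 ^ 3 - 147 * SZ 5 ^ 2, ?_⟩
  have : 1728 * (PowerSeries.mk c + 100 * SZ 3 ^ 2 + 8000 * SZ 3 ^ 3 - 147 * SZ 5 ^ 2)
    = 144 * (12 * PowerSeries.mk c) + 1728 * (100 * SZ 3 ^ 2 + 8000 * SZ 3 ^ 3 - 147 * SZ 5 ^ 2) := by ring
  rw [this, ← hc', E4Z, E6Z]
  ring

def DZ : PowerSeries ℤ := exists_DZ.choose

lemma Dl_inv : Inv1 12 Dl := fun g =>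
  SlashInvariantForm.slash_action_generators_SL2Z ModularForm.discriminant_S_invariant ModularForm.discriminant_T_invariant g

lemma Dl_HX1 : HX 1 Dl (toC DZ) := by
  have h1 := ((E4_HX1.pow 3).sub (E6_HX1.pow 2)).smul (1 / 1728 : ℂ)
  have h2 : Dl = (1 / 1728 : ℂ) • (E4 ^ 3 - E6 ^ 2) := by
    funext z
    simp only [Dl, ModularForm.discriminant_eq_E₄_cube_sub_E₆_sq, E4, E6, Pi.smul_apply, Pi.sub_apply,
      Pi.pow_apply, smul_eq_mul]
    ring
  rw [h2]
  convert! h1 using 1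
  rw [← map_pow, ← map_pow, ← map_sub, ← exists_DZ.choose_spec]
  ext n
  rw [map_smul, PowerSeries.coeff_map, PowerSeries.coeff_map, coeff_num]
  simp [DZ]

lemma DZ_zero : coeff 0 DZ = 0 := by
  have h := congrArg (coeff 0) exists_DZ.choose_spec
  rw [coeff_num] at h
  have h2 : coeff 0 (E4Z ^ 3 - E6Z ^ 2) = 0 := by
    have h4 : PowerSeries.constantCoeff E4Z = 1 := by
      rw [← PowerSeries.coeff_zero_eq_constantCoeff_apply, E4Z_coeff]; simp
    have h6 : PowerSeries.constantCoeff E6Z = 1 := by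
      rw [← PowerSeries.coeff_zero_eq_constantCoeff_apply, E6Z_coeff]; simp
    simp [h4, h6]
  rw [h2] at h
  simpa [DZ] using h

lemma DZ_one : coeff 1 DZ = 1 := by
  obtain ⟨M, hM⟩ := toMF le_rfl Dl_inv Dl_HX1
  have h1 : HX 1 Dl (qExpansion 1 Dl) := by rw [← hM]; exact HX_MF M
  have h2 := Dl_HX1.unique le_rfl h1
  have h3 := congrArg (coeff 1) h2
  rw [PowerSeries.coeff_map, Dl, ModularForm.discriminant_qExpansion_coeff_one] at h3
  simpa using h3

lemma E4Z_zero : coeff 0 E4Z = 1 := by simp only [E4Z_coeff]; simp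
lemma E6Z_zero : coeff 0 E6Z = 1 := by simp only [E6Z_coeff]; simp

lemma E4_inv : Inv1 4 E4 := Inv1_MF _
lemma E6_inv : Inv1 6 E6 := Inv1_MF _

lemma mem_toC_mul (I : AddSubgroup ℂ) (R : PowerSeries ℤ) (p : PowerSeries ℂ) (n : ℕ)
    (h : ∀ m ≤ n, coeff m p ∈ I) : coeff n (toC R * p) ∈ I := by
  rw [PowerSeries.coeff_mul]
  refine sum_mem fun x hx => ?_
  have hx := Finset.HasAntidiagonal.mem_antidiagonal.mp hx
  simp only [PowerSeries.coeff_map, eq_intCast]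
  rw [← zsmul_eq_mul]
  exact zsmul_mem (h _ (by omega)) _

lemma coeff_DZ_mul (p : PowerSeries ℂ) (n : ℕ) :
    coeff (n + 1) (toC DZ * p) = coeff n p +
      ∑ i ∈ Finset.range n, coeff i p * (coeff (n + 1 - i) DZ : ℤ) := by
  rw [mul_comm, PowerSeries.coeff_mul, Finset.Nat.sum_antidiagonal_eq_sum_range_succ_mk,
    Finset.sum_range_succ, Finset.sum_range_succ]
  simp [DZ_zero, DZ_one]
  ring

lemma mem_of_DZ_mul (I : AddSubgroup ℂ) (p : PowerSeries ℂ) (n : ℕ)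
    (h : ∀ m ≤ n + 1, coeff m (toC DZ * p) ∈ I) : coeff n p ∈ I := by
  induction n using Nat.strong_induction_on with
  | _ n ih =>
    have h1 := h (n + 1) le_rfl
    rw [coeff_DZ_mul] at h1
    refine (AddSubgroup.add_mem_cancel_right I ?_).mp h1
    refine sum_mem fun i hi => ?_
    have hi := Finset.mem_range.mp hi
    rw [mul_comm, ← zsmul_eq_mul]
    exact zsmul_mem (ih i hi fun m hm => h m (by omega)) _

lemma Inv1.pow {k : ℤ} {F : ℍ → ℂ} (hF : Inv1 k F) (n : ℕ) : Inv1 (k * n) (F ^ n) := by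
  induction n with
  | zero => simpa using! ModularForm.is_invariant_one
  | succ n ih =>
    rw [pow_succ, show k * ((n + 1 : ℕ) : ℤ) = k * n + k by push_cast; ring]
    exact ih.mul hF

lemma Inv1.sub {k : ℤ} {F G : ℍ → ℂ} (hF : Inv1 k F) (hG : Inv1 k G) : Inv1 k (F - G) := fun g => by
  rw [sub_eq_add_neg, SlashAction.add_slash, SlashAction.neg_slash, hF g, hG g]

lemma Inv1.smul {k : ℤ} {F : ℍ → ℂ} (c : ℂ) (hF : Inv1 k F) : Inv1 k (c • F) := fun g => by
  rw [ModularForm.SL_smul_slash, hF g]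

lemma lvl1_struct (t : ℕ) : ∀ (F : ℍ → ℂ) (p : PowerSeries ℂ), Inv1 (12 * t) F → HX 1 F p →
    ∃ a : ℕ → ℂ, F = ∑ j ∈ Finset.range (t + 1), a j • (Dl ^ j * E4 ^ (3 * (t - j))) ∧
      ∀ I : AddSubgroup ℂ, (∀ n ≤ t, coeff n p ∈ I) → ∀ j ≤ t, a j ∈ I := by
  induction t with
  | zero =>
    intro F p hF hp
    obtain ⟨M, rfl⟩ := toMF le_rfl hF hp
    obtain ⟨M', hM'⟩ : ∃ M' : ModularForm 𝒮ℒ 0, ⇑M' = ⇑M := toMF le_rfl (by simpa using hF) hp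
    obtain ⟨c, hc⟩ := ModularFormClass.levelOne_weight_zero_const M'
    rw [← hM', hc] at hp ⊢
    have hpc := hp.unique le_rfl (HX.const c)
    refine ⟨fun _ => c, ?_, ?_⟩
    · funext z; simp
    · intro I hI j _
      have := hI 0 le_rfl
      simpa [hpc] using this
  | succ t ih =>
    intro F p hF hp
    have hE : HX 1 (E4 ^ (3 * (t + 1))) (toC (E4Z ^ (3 * (t + 1)))) := by
      rw [map_pow]; exact E4_HX1.pow _
    have hE0 : coeff 0 (toC (E4Z ^ (3 * (t + 1)))) = 1 := by
      have : PowerSeries.constantCoeff E4Z = 1 := by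
        rw [← PowerSeries.coeff_zero_eq_constantCoeff_apply, E4Z_zero]
      rw [PowerSeries.coeff_map, PowerSeries.coeff_zero_eq_constantCoeff_apply, map_pow, this]
      simp
    have hG := hp.sub (hE.smul (coeff 0 p))
    have hGi : Inv1 (12 * (t + 1 : ℕ)) (F - (coeff 0 p) • (E4 ^ (3 * (t + 1)))) := by
      refine hF.sub (Inv1.smul _ ?_)
      have := E4_inv.pow (3 * (t + 1))
      convert this using 1
      push_cast; ring
    obtain ⟨M, hM⟩ := toMF le_rfl hGi hG
    have hq := (HX_MF M).unique le_rfl (hM ▸ hG)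
    have hc : (qExpansion 1 M).coeff 0 = 0 := by
      rw [hq, map_sub, map_smul, hE0]; simp
    have hd := ModularForm.discriminant_mul_discriminantEquiv (ModularForm.toCuspForm M hc)
    set G' := CuspForm.discriminantEquiv (ModularForm.toCuspForm M hc) with hG'
    have hd2 : Dl * (G' : ℍ → ℂ) = F - (coeff 0 p) • (E4 ^ (3 * (t + 1))) := by
      rw [← hM]; exact hd
    obtain ⟨a, ha, hI⟩ := ih G' (qExpansion 1 G') (by
      have := Inv1_MF G'
      convert this using 1
      push_cast; ring) (HX_MF G')
    have hprod := (Dl_HX1.mul (HX_MF G')).unique le_rfl (hd2 ▸ hG)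
    refine ⟨fun j => Nat.casesOn j (coeff 0 p) a, ?_, ?_⟩
    · rw [Finset.sum_range_succ']
      have : F = Dl * (G' : ℍ → ℂ) + (coeff 0 p) • (E4 ^ (3 * (t + 1))) := by rw [hd2]; ring
      rw [this]
      congr 1
      · rw [ha, Finset.mul_sum]
        refine Finset.sum_congr rfl fun j hj => ?_
        rw [Nat.add_sub_add_right, mul_smul_comm, pow_succ]
        ring_nf
      · simp
    · intro I hp'
      have h1 : ∀ n ≤ t, coeff n (qExpansion 1 G') ∈ I := by
        intro n hn
        refine mem_of_DZ_mul I _ n fun m hm => ?_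
        rw [hprod, map_sub, map_smul, smul_eq_mul]
        refine sub_mem (hp' m (by omega)) ?_
        rw [PowerSeries.coeff_map, mul_comm, eq_intCast, ← zsmul_eq_mul]
        exact zsmul_mem (hp' 0 (by omega)) _
      intro j hj
      cases j with
      | zero => exact hp' 0 (by omega)
      | succ j => exact hI I h1 j (by omega)

def lvZ (t j : ℕ) : PowerSeries ℤ := DZ ^ j * E4Z ^ (3 * (t - j))

lemma lv_HX (t j : ℕ) : HX 1 (Dl ^ j * E4 ^ (3 * (t - j))) (toC (lvZ t j)) := by
  rw [lvZ, map_mul, map_pow, map_pow]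
  exact (Dl_HX1.pow _).mul (E4_HX1.pow _)

lemma lv_inv (t j : ℕ) (hj : j ≤ t) : Inv1 (12 * t) (Dl ^ j * E4 ^ (3 * (t - j))) := by
  have := (Dl_inv.pow j).mul (E4_inv.pow (3 * (t - j)))
  convert this using 1
  push_cast [hj]; ring

lemma sturm (t : ℕ) (F : ℍ → ℂ) (p : PowerSeries ℂ) (hF : Inv1 (12 * t) F) (hp : HX 1 F p)
    (I : AddSubgroup ℂ) (h : ∀ n ≤ t, coeff n p ∈ I) (n : ℕ) : coeff n p ∈ I := by
  obtain ⟨a, ha, hI⟩ := lvl1_struct t F p hF hp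
  have h2 := HX.sum (N := 1) (Finset.range (t + 1)) (fun j _ => (lv_HX t j).smul (a j))
  rw [← ha] at h2
  rw [hp.unique le_rfl h2, map_sum]
  refine sum_mem fun j hj => ?_
  rw [map_smul, PowerSeries.coeff_map, smul_eq_mul, mul_comm, eq_intCast, ← zsmul_eq_mul]
  exact zsmul_mem (hI I h j (by simpa [Nat.lt_succ_iff] using hj)) _

/-- change of width -/
lemma HX.expand {N : ℕ} (hN : 1 ≤ N) {f : ℍ → ℂ} {p : PowerSeries ℂ} (h : HX 1 f p) :
    HX N f (PowerSeries.mk fun n => if N ∣ n then coeff (n / N) p else 0) := by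
  have h1 : ∀ τ, HasSum (fun n => coeff n p * qn N τ ^ (N * n)) (f τ) := fun τ => by
    have hq : qn N τ ^ N = qn 1 τ := by
      rw [qn, qn, ← Complex.exp_nat_mul]
      congr 1
      have : (N : ℂ) ≠ 0 := by exact_mod_cast (by omega : N ≠ 0)
      field_simp
      simp
    simpa [pow_mul, hq] using h τ
  convert! HX_of_fiber _ _ h1 using 1
  ext n
  simp only [PowerSeries.coeff_mk]
  split_ifs with hn
  · obtain ⟨m, rfl⟩ := hn
    have : (fun n => N * n) ⁻¹' {N * m} = {m} := by
      ext x; simp; omega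
    rw [this, tsum_singleton m (fun n => coeff n p), Nat.mul_div_cancel_left _ (by omega)]
  · have : (fun n => N * n) ⁻¹' {n} = ∅ := by
      ext x; simp; rintro rfl; simp at hn
    rw [this]; simp

/-- a level one form with an `N`-expansion has a `1`-expansion -/
lemma HX.contract {N : ℕ} (hN : 1 ≤ N) {k : ℤ} {F : ℍ → ℂ} {p : PowerSeries ℂ} (hF : Inv1 k F)
    (h : HX N F p) : HX 1 F (PowerSeries.mk fun n => coeff (N * n) p) ∧
      ∀ n, ¬ N ∣ n → coeff n p = 0 := by
  obtain ⟨M, rfl⟩ := toMF hN hF h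
  have h1 := HX_MF M
  have h2 := h.unique hN (h1.expand hN)
  constructor
  · convert! h1
    ext n
    simp [h2, Nat.mul_div_cancel_left _ (show 0 < N by omega)]
  · intro n hn
    simp [h2, hn]

end QP

namespace QP
open PowerSeries (coeff)
open scoped Manifold

lemma zeta_pow {N : ℕ} (hN : 1 ≤ N) : zetaC N ^ N = 1 := by
  have : (N : ℂ) ≠ 0 := by exact_mod_cast (by omega : N ≠ 0)
  rw [zetaC, ← Complex.exp_nat_mul, mul_div_cancel₀ _ this, Complex.exp_two_pi_mul_I]

lemma zeta_prim {N : ℕ} (hN : 1 ≤ N) : IsPrimitiveRoot (zetaC N) N :=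
  Complex.isPrimitiveRoot_exp N (by omega)

lemma zeta_ne (N : ℕ) : zetaC N ≠ 0 := Complex.exp_ne_zero _

/-- local data -/
structure Loc (N : ℕ) where
  B : Subring ℂ
  w : ℂ
  w_mem : w ∈ B
  w_ne : w ≠ 0
  dich : ∀ x ∈ B, (∃ b ∈ B, x = w * b) ∨ x⁻¹ ∈ B
  w_inv : w⁻¹ ∉ B
  sep : ∀ x, (∀ n : ℕ, ∃ b ∈ B, x = w ^ n * b) → x = 0
  zeta : zetaC N ∈ B
  Ninv : (N : ℂ)⁻¹ ∈ B

/-- power series with coefficients in a subring -/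
def IntS (B : Subring ℂ) : Subring (PowerSeries ℂ) where
  carrier := {p | ∀ n, coeff n p ∈ B}
  mul_mem' := fun {p q} hp hq n => by
    rw [PowerSeries.coeff_mul]
    exact sum_mem fun x _ => B.mul_mem (hp _) (hq _)
  one_mem' := fun n => by
    rw [PowerSeries.coeff_one]; split_ifs <;> simp
  add_mem' := fun {p q} hp hq n => by
    rw [map_add]; exact add_mem (hp _) (hq _)
  zero_mem' := fun n => by simp
  neg_mem' := fun {p} hp n => by rw [map_neg]; exact neg_mem (hp _)

lemma mem_IntS {B : Subring ℂ} {p : PowerSeries ℂ} : p ∈ IntS B ↔ ∀ n, coeff n p ∈ B := Iff.rfl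

lemma smul_IntS {B : Subring ℂ} {p : PowerSeries ℂ} {c : ℂ} (hc : c ∈ B) (hp : p ∈ IntS B) :
    c • p ∈ IntS B := fun n => by rw [map_smul]; exact B.mul_mem hc (hp n)

lemma toC_IntS (B : Subring ℂ) (p : PowerSeries ℤ) : toC p ∈ IntS B := fun n => by
  rw [PowerSeries.coeff_map]; simp

/-- weight-k slash by SL2Z with natural weight -/
abbrev sl (k : ℕ) (f : ℍ → ℂ) (g : SL(2, ℤ)) : ℍ → ℂ := f ∣[(k : ℤ)] g

lemma sl_comp (k : ℕ) (f : ℍ → ℂ) (g h : SL(2, ℤ)) : sl k (sl k f g) h = sl k f (g * h) :=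
  (SlashAction.slash_mul _ _ _ _).symm

lemma sl_one (k : ℕ) (f : ℍ → ℂ) : sl k f 1 = f := SlashAction.slash_one _ _

lemma sl_mul (k l : ℕ) (f f' : ℍ → ℂ) (g : SL(2, ℤ)) :
    sl (k + l) (f * f') g = sl k f g * sl l f' g := by
  rw [sl, Nat.cast_add]; exact ModularForm.mul_slash_SL2 _ _ _ _ _

lemma sl_pow (k n : ℕ) (f : ℍ → ℂ) (g : SL(2, ℤ)) : sl (k * n) (f ^ n) g = sl k f g ^ n := by
  induction n with
  | zero => simpa using! ModularForm.is_invariant_one g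
  | succ n ih => rw [pow_succ, pow_succ, Nat.mul_succ, sl_mul, ih]

lemma sl_prod {ι : Type*} (k : ℕ) (s : Finset ι) (f : ι → ℍ → ℂ) (g : SL(2, ℤ)) :
    sl (k * s.card) (∏ i ∈ s, f i) g = ∏ i ∈ s, sl k (f i) g := by
  classical
  induction s using Finset.induction_on with
  | empty => simpa using! ModularForm.is_invariant_one g
  | insert a s ha ih =>
    rw [Finset.prod_insert ha, Finset.prod_insert ha, Finset.card_insert_of_notMem ha, Nat.mul_succ,
      add_comm, sl_mul, ih]

lemma sl_sum {ι : Type*} (k : ℕ) (s : Finset ι) (f : ι → ℍ → ℂ) (g : SL(2, ℤ)) :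
    sl k (∑ i ∈ s, f i) g = ∑ i ∈ s, sl k (f i) g := SlashAction.sum_slash ..

lemma sl_add (k : ℕ) (f f' : ℍ → ℂ) (g : SL(2, ℤ)) : sl k (f + f') g = sl k f g + sl k f' g :=
  SlashAction.add_slash ..

lemma sl_neg (k : ℕ) (f : ℍ → ℂ) (g : SL(2, ℤ)) : sl k (-f) g = - sl k f g :=
  SlashAction.neg_slash ..

lemma sl_sub (k : ℕ) (f f' : ℍ → ℂ) (g : SL(2, ℤ)) : sl k (f - f') g = sl k f g - sl k f' g := by
  rw [sub_eq_add_neg, sl_add, sl_neg, sub_eq_add_neg]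

lemma sl_smul (k : ℕ) (c : ℂ) (f : ℍ → ℂ) (g : SL(2, ℤ)) : sl k (c • f) g = c • sl k f g :=
  ModularForm.SL_smul_slash ..

lemma sl_apply (k : ℕ) (f : ℍ → ℂ) (g : SL(2, ℤ)) (τ : ℍ) :
    sl k f g τ = f (g • τ) * (((g 1 0 : ℤ) : ℂ) * τ + ((g 1 1 : ℤ) : ℂ)) ^ (-(k : ℤ)) := by
  rw [sl, ModularForm.SL_slash_apply, ModularGroup.denom_apply]

lemma sl_T {N : ℕ} {k : ℕ} {f : ℍ → ℂ} {p : PowerSeries ℂ} (h : HX N f p) :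
    HX N (sl k f ModularGroup.T) (PowerSeries.rescale (zetaC N) p) := fun τ => by
  have h1 : sl k f ModularGroup.T τ = f (ModularGroup.T • τ) := by
    rw [sl_apply]
    simp [ModularGroup.T]
  rw [h1]
  convert h (ModularGroup.T • τ) using 2 with n
  rw [PowerSeries.coeff_rescale]
  have : qn N (ModularGroup.T • τ) = zetaC N * qn N τ := by
    rw [qn, qn, zetaC, ← Complex.exp_add, UpperHalfPlane.modular_T_smul]
    congr 1
    simp
    ring
  rw [this, mul_pow]
  ring

lemma sl_neg_one {k : ℕ} (hk : Even k) (f : ℍ → ℂ) : sl k f (-1) = f := by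
  funext τ
  rw [sl_apply]
  simp [hk.neg_one_pow]

/-- forms of level N -/
def GInv (N k : ℕ) (f : ℍ → ℂ) : Prop := ∀ γ ∈ CongruenceSubgroup.Gamma N, sl k f γ = f

lemma GInv.mul {N k l : ℕ} {f g : ℍ → ℂ} (hf : GInv N k f) (hg : GInv N l g) :
    GInv N (k + l) (f * g) := fun γ h => by rw [sl_mul, hf γ h, hg γ h]

lemma GInv.slash {N k : ℕ} {f : ℍ → ℂ} (hf : GInv N k f) (g : SL(2, ℤ)) :
    GInv N k (sl k f g) := fun γ h => by
  have : g * γ = (g * γ * g⁻¹) * g := by group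
  rw [sl_comp, this, ← sl_comp, hf _ ((Gamma_normal N).conj_mem γ h g)]

/-- forms with all expansions having coefficients in `B` -/
def Lk (N : ℕ) (B : Subring ℂ) (k : ℕ) (f : ℍ → ℂ) : Prop :=
  GInv N k f ∧ ∀ g, ∃ p ∈ IntS B, HX N (sl k f g) p

section
variable {N : ℕ} {B : Subring ℂ} {k l : ℕ} {f g : ℍ → ℂ}

lemma Lk.exp (hf : Lk N B k f) : ∃ p ∈ IntS B, HX N f p := by
  simpa [sl_one] using hf.2 1

lemma Lk.mul (hf : Lk N B k f) (hg : Lk N B l g) : Lk N B (k + l) (f * g) :=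
  ⟨hf.1.mul hg.1, fun x => by
    obtain ⟨p, hp, hp'⟩ := hf.2 x
    obtain ⟨q, hq, hq'⟩ := hg.2 x
    exact ⟨p * q, mul_mem hp hq, by rw [sl_mul]; exact hp'.mul hq'⟩⟩

lemma Lk.slash (hf : Lk N B k f) (x : SL(2, ℤ)) : Lk N B k (sl k f x) :=
  ⟨hf.1.slash x, fun y => by rw [sl_comp]; exact hf.2 _⟩

lemma Lk.pow (hf : Lk N B k f) (n : ℕ) : Lk N B (k * n) (f ^ n) :=
  ⟨fun γ h => by rw [sl_pow, hf.1 γ h], fun x => by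
    obtain ⟨p, hp, hp'⟩ := hf.2 x
    exact ⟨p ^ n, pow_mem hp n, by rw [sl_pow]; exact hp'.pow n⟩⟩

lemma Lk.prod {ι : Type*} (s : Finset ι) {f : ι → ℍ → ℂ} (hf : ∀ i ∈ s, Lk N B k (f i)) :
    Lk N B (k * s.card) (∏ i ∈ s, f i) := by
  refine ⟨fun γ h => ?_, fun x => ?_⟩
  · rw [sl_prod]; exact Finset.prod_congr rfl fun i hi => (hf i hi).1 γ h
  · choose! p hp hp' using fun i hi => (hf i hi).2 x
    exact ⟨_, prod_mem hp, by rw [sl_prod]; exact HX.prod s hp'⟩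

lemma Lk.sum {ι : Type*} (s : Finset ι) {f : ι → ℍ → ℂ} (hf : ∀ i ∈ s, Lk N B k (f i)) :
    Lk N B k (∑ i ∈ s, f i) := by
  refine ⟨fun γ h => ?_, fun x => ?_⟩
  · rw [sl_sum]; exact Finset.sum_congr rfl fun i hi => (hf i hi).1 γ h
  · choose! p hp hp' using fun i hi => (hf i hi).2 x
    exact ⟨_, sum_mem hp, by rw [sl_sum]; exact HX.sum s hp'⟩

lemma Lk.sub (hf : Lk N B k f) (hg : Lk N B k g) : Lk N B k (f - g) :=
  ⟨fun γ h => by rw [sl_sub, hf.1 γ h, hg.1 γ h], fun x => by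
    obtain ⟨p, hp, hp'⟩ := hf.2 x
    obtain ⟨q, hq, hq'⟩ := hg.2 x
    exact ⟨p - q, sub_mem hp hq, by rw [sl_sub]; exact hp'.sub hq'⟩⟩

lemma Lk.neg (hf : Lk N B k f) : Lk N B k (-f) :=
  ⟨fun γ h => by rw [sl_neg, hf.1 γ h], fun x => by
    obtain ⟨p, hp, hp'⟩ := hf.2 x
    exact ⟨-p, neg_mem hp, by rw [sl_neg]; exact hp'.neg⟩⟩

lemma Lk.smul {c : ℂ} (hc : c ∈ B) (hf : Lk N B k f) : Lk N B k (c • f) :=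
  ⟨fun γ h => by rw [sl_smul, hf.1 γ h], fun x => by
    obtain ⟨p, hp, hp'⟩ := hf.2 x
    exact ⟨c • p, smul_IntS hc hp, by rw [sl_smul]; exact hp'.smul c⟩⟩

lemma Lk_lvl1 (hN : 1 ≤ N) {p : PowerSeries ℤ} (hf : Inv1 k f) (hp : HX 1 f (toC p)) : Lk N B k f :=
  ⟨fun γ _ => hf γ, fun x => ⟨PowerSeries.mk fun n => if N ∣ n then coeff (n / N) (toC p) else 0, fun n => by
    rw [PowerSeries.coeff_mk]
    split_ifs
    · exact toC_IntS B p _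
    · exact zero_mem _, by rw [sl, hf x]; exact hp.expand hN⟩⟩
end

namespace Loc
variable {N : ℕ} (Λ : Loc N)

def W : AddSubgroup ℂ where
  carrier := {x | ∃ b ∈ Λ.B, x = Λ.w * b}
  add_mem' := by
    rintro _ _ ⟨a, ha, rfl⟩ ⟨b, hb, rfl⟩
    exact ⟨a + b, add_mem ha hb, by ring⟩
  zero_mem' := ⟨0, zero_mem _, by ring⟩
  neg_mem' := by
    rintro _ ⟨a, ha, rfl⟩
    exact ⟨-a, neg_mem ha, by ring⟩

lemma W_mul {x y : ℂ} (hx : x ∈ Λ.B) (hy : y ∈ Λ.W) : x * y ∈ Λ.W := by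
  obtain ⟨b, hb, rfl⟩ := hy
  exact ⟨x * b, mul_mem hx hb, by ring⟩

lemma W_le {x : ℂ} (hx : x ∈ Λ.W) : x ∈ Λ.B := by
  obtain ⟨b, hb, rfl⟩ := hx
  exact mul_mem Λ.w_mem hb

lemma one_W : (1 : ℂ) ∉ Λ.W := by
  rintro ⟨b, hb, h⟩
  exact Λ.w_inv ((eq_inv_of_mul_eq_one_right h.symm) ▸ hb)

lemma unit_W {x : ℂ} (hx : x⁻¹ ∈ Λ.B) (h0 : x ≠ 0) : x ∉ Λ.W := fun h => by
  have := Λ.W_mul hx h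
  rw [inv_mul_cancel₀ h0] at this
  exact Λ.one_W this

lemma W_prime {x y : ℂ} (hx : x ∈ Λ.B) (hxy : x * y ∈ Λ.W) : x ∈ Λ.W ∨ y ∈ Λ.W := by
  rcases Λ.dich x hx with h | h
  · exact Or.inl h
  · by_cases h0 : x = 0
    · left; rw [h0]; exact zero_mem _
    · right
      have := Λ.W_mul h hxy
      rwa [inv_mul_cancel_left₀ h0] at this

def ZS (p : PowerSeries ℂ) : Prop := ∀ n, coeff n p ∈ Λ.W

lemma ZS_mul {p q : PowerSeries ℂ} (hp : p ∈ IntS Λ.B) (hq : Λ.ZS q) : Λ.ZS (p * q) := fun n => by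
  rw [PowerSeries.coeff_mul]
  exact sum_mem fun x _ => Λ.W_mul (hp _) (hq _)

lemma gauss {p q : PowerSeries ℂ} (hp : p ∈ IntS Λ.B) (hq : q ∈ IntS Λ.B) (h : Λ.ZS (p * q)) :
    Λ.ZS p ∨ Λ.ZS q := by
  classical
  by_contra! hcon
  obtain ⟨h1, h2⟩ := hcon
  simp only [ZS, not_forall] at h1 h2
  have e1 := Nat.find_spec h1
  have e2 := Nat.find_spec h2
  have m1 := fun m => Nat.find_min h1 (m := m)
  have m2 := fun m => Nat.find_min h2 (m := m)
  set i := Nat.find h1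
  set j := Nat.find h2
  have h3 := h (i + j)
  rw [PowerSeries.coeff_mul, ← Finset.add_sum_erase _ _ (a := (i, j)) (by simp)] at h3
  have h4 : ∑ x ∈ (Finset.HasAntidiagonal.antidiagonal (i + j)).erase (i, j), coeff x.1 p * coeff x.2 q ∈ Λ.W := by
    refine sum_mem fun x hx => ?_
    obtain ⟨hne, hx⟩ := Finset.mem_erase.mp hx
    have hx := Finset.HasAntidiagonal.mem_antidiagonal.mp hx
    by_cases hxi : x.1 < i
    · rw [mul_comm]; exact Λ.W_mul (hq _) (by simpa using m1 _ hxi)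
    · have hlt : x.2 < j := by
        by_contra hc
        exact hne (Prod.ext (by dsimp only; omega) (by dsimp only; omega))
      exact Λ.W_mul (hp _) (by simpa using m2 x.2 hlt)
  have h5 := (AddSubgroup.add_mem_cancel_right _ h4).mp h3
  rcases Λ.W_prime (hp i) h5 with h | h
  · exact e1 h
  · exact e2 h

/-- vanishing mod w -/
def Z (f : ℍ → ℂ) : Prop := ∃ p, HX N f p ∧ Λ.ZS p

lemma zeta_inv (hN : 1 ≤ N) : (zetaC N)⁻¹ ∈ Λ.B := by
  have : (zetaC N)⁻¹ = zetaC N ^ (N - 1) := by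
    rw [inv_eq_iff_eq_inv, eq_comm]
    refine inv_eq_of_mul_eq_one_left ?_
    rw [← pow_succ', Nat.sub_add_cancel hN, zeta_pow hN]
  rw [this]; exact pow_mem Λ.zeta _

end Loc
end QP

namespace QP
open PowerSeries (coeff)
open scoped Manifold

lemma HX_of_pow {N E : ℕ} (hE : 0 < E) {c : ℕ → ℂ} {f : ℍ → ℂ}
    (h : ∀ τ, HasSum (fun n => c n * (qn N τ ^ E) ^ n) (f τ)) :
    HX N f (PowerSeries.mk fun n => if E ∣ n then c (n / E) else 0) := fun τ => by
  have hi : Function.Injective (fun n : ℕ => E * n) := fun a b h => Nat.eq_of_mul_eq_mul_left hE h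
  rw [← hi.hasSum_iff]
  · convert h τ using 2 with n
    simp [Nat.mul_div_cancel_left n hE, pow_mul]
  · intro n hn
    have : ¬ E ∣ n := by
      rintro ⟨m, rfl⟩
      exact hn ⟨m, rfl⟩
    simp [this]

/-- the point `(aτ+b)/d` -/
def pt (a d : ℕ) (ha : 0 < a) (hd : 0 < d) (b : ℤ) (τ : ℍ) : ℍ :=
  ⟨((a : ℂ) * τ + b) / d, by
    have : ((a : ℂ) * τ + b) / d = ((a / d : ℝ) : ℂ) * τ + ((b / d : ℝ) : ℂ) := by
      push_cast; ring
    rw [this, Complex.add_im, Complex.im_ofReal_mul, Complex.ofReal_im, add_zero]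
    have := τ.im_pos
    positivity⟩

lemma pt_coe (a d : ℕ) (ha : 0 < a) (hd : 0 < d) (b : ℤ) (τ : ℍ) :
    (pt a d ha hd b τ : ℂ) = ((a : ℂ) * τ + b) / d := rfl

def uM (M : ℕ) (hM : 0 < M) (τ : ℍ) : ℂ := Dl (pt M 1 hM one_pos 0 τ)

lemma cden_ne (h : SL(2, ℤ)) (τ : ℍ) : (((h 1 0 : ℤ) : ℂ) * τ + ((h 1 1 : ℤ) : ℂ)) ≠ 0 := by
  rw [← ModularGroup.denom_apply]; exact UpperHalfPlane.denom_ne_zero _ _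

lemma smul_coe (h : SL(2, ℤ)) (τ : ℍ) : ((h • τ : ℍ) : ℂ) =
    (((h 0 0 : ℤ) : ℂ) * τ + ((h 0 1 : ℤ) : ℂ)) / (((h 1 0 : ℤ) : ℂ) * τ + ((h 1 1 : ℤ) : ℂ)) := by
  rw [UpperHalfPlane.specialLinearGroup_apply]
  simp

lemma uM_slash_aux {M a d : ℕ} (hM : 0 < M) (ha : 0 < a) (hd : 0 < d) (b : ℤ) (h γ : SL(2, ℤ))
    (h00 : (M : ℤ) * h 0 0 = γ 0 0 * a) (h01 : (M : ℤ) * h 0 1 = γ 0 0 * b + γ 0 1 * d)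
    (h10 : h 1 0 = γ 1 0 * a) (h11 : h 1 1 = γ 1 0 * b + γ 1 1 * d) (τ : ℍ) :
    sl 12 (uM M hM) h τ = ((d : ℂ)⁻¹) ^ 12 * Dl (pt a d ha hd b τ) := by
  have hd' : (d : ℂ) ≠ 0 := by exact_mod_cast hd.ne'
  have e00 := congrArg (Int.cast : ℤ → ℂ) h00
  have e01 := congrArg (Int.cast : ℤ → ℂ) h01
  have e10 := congrArg (Int.cast : ℤ → ℂ) h10
  have e11 := congrArg (Int.cast : ℤ → ℂ) h11
  push_cast at e00 e01 e10 e11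
  have hden := cden_ne h τ
  have hgd := cden_ne γ (pt a d ha hd b τ)
  have key : pt M 1 hM one_pos 0 (h • τ) = γ • pt a d ha hd b τ := by
    ext1
    rw [smul_coe, pt_coe, smul_coe, pt_coe]
    rw [pt_coe] at hgd
    have : ((γ 1 0 : ℤ) : ℂ) * (((a : ℂ) * τ + b) / d) + ((γ 1 1 : ℤ) : ℂ) =
      (((h 1 0 : ℤ) : ℂ) * τ + ((h 1 1 : ℤ) : ℂ)) / d := by
      rw [e10, e11]; field_simp; ring
    rw [this]
    have : ((γ 0 0 : ℤ) : ℂ) * (((a : ℂ) * τ + b) / d) + ((γ 0 1 : ℤ) : ℂ) =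
      M * (((h 0 0 : ℤ) : ℂ) * τ + ((h 0 1 : ℤ) : ℂ)) / d := by
      field_simp
      linear_combination (-(τ : ℂ)) * e00 - e01
    rw [this]
    field_simp
    simp
  have hinv := congrFun (Dl_inv γ) (pt a d ha hd b τ)
  have hs := sl_apply 12 Dl γ (pt a d ha hd b τ)
  rw [sl_apply, uM, key, ← hinv]
  have hs' : (Dl ∣[(12 : ℤ)] γ) (pt a d ha hd b τ) = sl 12 Dl γ (pt a d ha hd b τ) := rfl
  rw [hs', hs]
  have : ((γ 1 0 : ℤ) : ℂ) * (pt a d ha hd b τ : ℂ) + ((γ 1 1 : ℤ) : ℂ) =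
      (((h 1 0 : ℤ) : ℂ) * τ + ((h 1 1 : ℤ) : ℂ)) / d := by
      rw [e10, e11, pt_coe]; field_simp; ring
  rw [this, zpow_neg, zpow_neg, zpow_natCast, zpow_natCast]
  field_simp

lemma uM_inv {M : ℕ} (hM : 0 < M) (h : SL(2, ℤ)) (hz : (M : ℤ) ∣ h 1 0) :
    sl 12 (uM M hM) h = uM M hM := by
  obtain ⟨z, hz⟩ := hz
  have hdet := h.det_coe
  rw [Matrix.det_fin_two] at hdet
  let γ : SL(2, ℤ) := ⟨!![h 0 0, M * h 0 1; z, h 1 1], by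
    rw [Matrix.det_fin_two_of]; rw [hz] at hdet; linarith⟩
  funext τ
  rw [uM_slash_aux hM hM one_pos 0 h γ]
  · simp [uM]
  · simp [γ]; ring
  · simp [γ]
  · simp [γ, hz]; ring
  · simp [γ]

lemma hnf {M : ℕ} (hM : 0 < M) (h : SL(2, ℤ)) : ∃ (γ : SL(2, ℤ)) (a d : ℕ) (b : ℤ), 
    0 < a ∧ 0 < d ∧ a * d = M ∧ a = Int.gcd M (h 1 0) ∧
    (M : ℤ) * h 0 0 = γ 0 0 * a ∧ (M : ℤ) * h 0 1 = γ 0 0 * b + γ 0 1 * d ∧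
    h 1 0 = γ 1 0 * a ∧ h 1 1 = γ 1 0 * b + γ 1 1 * d := by
  have hdet := h.det_coe
  rw [Matrix.det_fin_two] at hdet
  set a := Int.gcd M (h 1 0) with ha
  have ha0 : 0 < a := Int.gcd_pos_of_ne_zero_left _ (by exact_mod_cast hM.ne')
  obtain ⟨d, hd⟩ : a ∣ M := by exact_mod_cast (Int.gcd_dvd_left (M : ℤ) (h 1 0))
  obtain ⟨z, hz⟩ : (a : ℤ) ∣ h 1 0 := Int.gcd_dvd_right ..
  have hd0 : 0 < d := Nat.pos_of_ne_zero (by rintro rfl; omega)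
  have hMd : (M : ℤ) = a * d := by exact_mod_cast hd
  have ha' : (a : ℤ) ≠ 0 := by exact_mod_cast ha0.ne'
  have hcop : IsCoprime (d : ℤ) z := by
    rw [Int.isCoprime_iff_gcd_eq_one]
    have h1 : Int.gcd (a * d) (a * z) = a * Int.gcd d z := by
      rw [Int.gcd_mul_left]; simp
    rw [← hMd, ← hz, ← ha] at h1
    exact Nat.eq_of_mul_eq_mul_left ha0 (by omega)
  have hcop2 : IsCoprime (h 0 0) z := by
    refine ⟨h 1 1, -(h 0 1 * a), ?_⟩
    rw [hz] at hdet; linear_combination hdet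
  obtain ⟨s, t, hst⟩ : IsCoprime ((d : ℤ) * h 0 0) z := hcop.mul_left hcop2
  let γ : SL(2, ℤ) := ⟨!![d * h 0 0, -t; z, s], by
    rw [Matrix.det_fin_two_of]; linear_combination hst⟩
  refine ⟨γ, a, d, s * (M * h 0 1) + t * h 1 1, ha0, hd0, hd.symm, rfl, ?_, ?_, ?_, ?_⟩
  · simp [γ]; rw [hMd]; ring
  · simp [γ]
    rw [hz] at hdet
    rw [hMd]
    linear_combination (-(a : ℤ) * d * h 0 1 ) * hst + (- d * t) * hdet
  · simp [γ]; rw [hz]; ring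
  · simp [γ]
    rw [hz] at hdet
    rw [hMd]
    linear_combination (-(h 1 1)) * hst + (s * d) * hdet

lemma Loc.dinv {N : ℕ} (Λ : Loc N) {d : ℕ} (hN : 1 ≤ N) (hd : d ∣ N) : (d : ℂ)⁻¹ ∈ Λ.B := by
  obtain ⟨e, he⟩ := hd
  have : (d : ℂ)⁻¹ = e * (N : ℂ)⁻¹ := by
    have h1 : (e : ℂ) ≠ 0 := by
      have : e ≠ 0 := by rintro rfl; omega
      exact_mod_cast this
    rw [he]; push_cast
    rw [mul_inv]; field_simp
  rw [this]
  exact mul_mem (natCast_mem _ _) Λ.Ninv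

lemma Loc.zeta_zpow {N : ℕ} (Λ : Loc N) (hN : 1 ≤ N) (m : ℤ) : zetaC N ^ m ∈ Λ.B := by
  cases m with
  | ofNat m => simpa using pow_mem Λ.zeta m
  | negSucc m => rw [zpow_negSucc, ← inv_pow]; exact pow_mem (Λ.zeta_inv hN) _

/-- leading coefficient at n is a unit -/
def Loc.Lead {N : ℕ} (Λ : Loc N) (n : ℕ) (f : ℍ → ℂ) : Prop :=
  ∃ p ∈ IntS Λ.B, HX N f p ∧ (∀ m < n, coeff m p = 0) ∧ coeff n p ≠ 0 ∧ (coeff n p)⁻¹ ∈ Λ.B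

lemma uM_lead {N : ℕ} (Λ : Loc N) (hN : 1 ≤ N) {M : ℕ} (hM : 0 < M) (hMN : M ∣ N) (h : SL(2, ℤ)) :
    Λ.Lead ((Int.gcd M (h 1 0)) ^ 2 * (N / M)) (sl 12 (uM M hM) h) := by
  obtain ⟨γ, a, d, b, ha, hd, had, hag, h1, h2, h3, h4⟩ := hnf hM h
  rw [← hag]
  have hdN : d ∣ N := (Dvd.intro_left _ had).trans hMN
  obtain ⟨e, he⟩ := hMN
  have he0 : 0 < e := Nat.pos_of_ne_zero (by rintro rfl; omega)
  have hE : 0 < a ^ 2 * e := by positivity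
  have hNe : N / M = e := by rw [he]; exact Nat.mul_div_cancel_left _ hM
  rw [hNe]
  have hd' : (d : ℂ) ≠ 0 := by exact_mod_cast hd.ne'
  have ha' : (a : ℂ) ≠ 0 := by exact_mod_cast ha.ne'
  have he' : (e : ℂ) ≠ 0 := by exact_mod_cast he0.ne'
  set ε : ℂ := zetaC N ^ (b * (a * e : ℕ)) with hε
  have hq : ∀ τ : ℍ, qn 1 (pt a d ha hd b τ) = ε * qn N τ ^ (a ^ 2 * e) := fun τ => by
    rw [qn, qn, hε, zetaC, ← Complex.exp_int_mul, ← Complex.exp_nat_mul, ← Complex.exp_add, pt_coe]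
    congr 1
    rw [he, ← had]
    push_cast
    field_simp
    ring
  have hsum : ∀ τ, HasSum (fun n => (((d : ℂ)⁻¹) ^ 12 * (coeff n (toC DZ) * ε ^ n)) * (qn N τ ^ (a ^ 2 * e)) ^ n)
      (sl 12 (uM M hM) h τ) := fun τ => by
    rw [uM_slash_aux hM ha hd b h γ h1 h2 h3 h4]
    refine ((Dl_HX1 (pt a d ha hd b τ)).mul_left (((d : ℂ)⁻¹) ^ 12)).congr_fun fun n => ?_
    rw [hq, mul_pow]; ring
  have hdB := Λ.dinv hN hdN
  refine ⟨_, ?_, HX_of_pow hE hsum, ?_, ?_, ?_⟩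
  · intro n
    rw [PowerSeries.coeff_mk]
    split_ifs
    · exact mul_mem (pow_mem hdB _) (mul_mem (toC_IntS _ _ _) (pow_mem (Λ.zeta_zpow hN _) _))
    · exact zero_mem _
  · intro m hm
    rw [PowerSeries.coeff_mk]
    split_ifs with hdv
    · obtain rfl : m = 0 := Nat.eq_zero_of_dvd_of_lt hdv hm
      simp [toC, DZ_zero]
    · rfl
  · rw [PowerSeries.coeff_mk]
    simp [Nat.div_self hE, toC, DZ_one, hd', hε, zeta_ne, zpow_ne_zero]
  · rw [PowerSeries.coeff_mk]
    simp only [dvd_refl, if_true, Nat.div_self hE, toC, PowerSeries.coeff_map, DZ_one]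
    rw [mul_inv, inv_pow, inv_inv]
    refine mul_mem (pow_mem (natCast_mem _ _) _) ?_
    simp only [hε, map_one, one_mul, pow_one, ← zpow_neg]
    exact Λ.zeta_zpow hN _

lemma Loc.Lead.int {N : ℕ} {Λ : Loc N} {n : ℕ} {f : ℍ → ℂ} (h : Λ.Lead n f) : ∃ p ∈ IntS Λ.B, HX N f p :=
  let ⟨p, hp, hp', _⟩ := h; ⟨p, hp, hp'⟩

lemma gamma_low {N : ℕ} {γ : SL(2, ℤ)} (h : γ ∈ CongruenceSubgroup.Gamma N) : (N : ℤ) ∣ γ 1 0 := by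
  rw [CongruenceSubgroup.Gamma_mem] at h
  exact (ZMod.intCast_zmod_eq_zero_iff_dvd _ _).mp h.2.2.1

lemma uM_Lk {N : ℕ} (Λ : Loc N) (hN : 1 ≤ N) {M : ℕ} (hM : 0 < M) (hMN : M ∣ N) :
    Lk N Λ.B 12 (uM M hM) :=
  ⟨fun γ h => uM_inv hM γ ((by exact_mod_cast hMN : (M : ℤ) ∣ N).trans (gamma_low h)),
    fun g => (uM_lead Λ hN hM hMN g).int⟩

end QP

namespace QP
open PowerSeries (coeff)
open scoped Manifold

lemma coset_prod {G M : Type*} [Group G] [CommMonoid M] (H : Subgroup G) [Fintype (G ⧸ H)] (φ : G → M)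
    (hφ : ∀ h ∈ H, ∀ x, φ (h * x) = φ x) (g : G) :
    ∏ q : G ⧸ H, φ (q.out⁻¹ * g) = ∏ q : G ⧸ H, φ (q.out⁻¹) := by
  let Φ : G ⧸ H → M := fun q => Quotient.liftOn' q (fun x => φ x⁻¹) (by
    intro a b hab
    rw [QuotientGroup.leftRel_apply] at hab
    have := hφ _ hab b⁻¹
    simpa using this)
  have hΦ : ∀ x : G, Φ (x : G ⧸ H) = φ x⁻¹ := fun x => rfl
  have h1 : ∀ q : G ⧸ H, φ (q.out⁻¹ * g) = Φ (g⁻¹ • q) := fun q => by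
    conv_rhs => rw [← QuotientGroup.out_eq' q]
    rw [MulAction.Quotient.smul_coe, hΦ]
    simp
  have h2 : ∀ q : G ⧸ H, φ (q.out⁻¹) = Φ q := fun q => by
    conv_rhs => rw [← QuotientGroup.out_eq' q]
    rw [hΦ]
  simp_rw [h1, h2]
  exact Equiv.prod_comp (MulAction.toPerm g⁻¹) Φ

lemma coset_sum {G M : Type*} [Group G] [AddCommMonoid M] (H : Subgroup G) [Fintype (G ⧸ H)] (φ : G → M)
    (hφ : ∀ h ∈ H, ∀ x, φ (h * x) = φ x) (g : G) :
    ∑ q : G ⧸ H, φ (q.out⁻¹ * g) = ∑ q : G ⧸ H, φ (q.out⁻¹) :=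
  coset_prod (M := Multiplicative M) H φ hφ g

lemma out_mem {G : Type*} [Group G] (H : Subgroup G) (q : G ⧸ H) : q.out⁻¹ ∈ H ↔ q = ((1 : G) : G ⧸ H) := by
  conv_rhs => rw [← QuotientGroup.out_eq' q, eq_comm, QuotientGroup.eq]
  simp

namespace Loc
variable {N : ℕ} {Λ : Loc N} {k l : ℕ} {f g : ℍ → ℂ} {p : PowerSeries ℂ}

lemma Z_iff (hN : 1 ≤ N) (hp : HX N f p) : Λ.Z f ↔ Λ.ZS p :=
  ⟨fun ⟨q, hq, h⟩ => hp.unique hN hq ▸ h, fun h => ⟨p, hp, h⟩⟩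

lemma Z.mul_left (hf : ∃ p ∈ IntS Λ.B, HX N f p) (hg : Λ.Z g) : Λ.Z (f * g) := by
  obtain ⟨p, hp, hp'⟩ := hf
  obtain ⟨q, hq, hq'⟩ := hg
  exact ⟨p * q, hp'.mul hq, Λ.ZS_mul hp hq'⟩

lemma Z.mul_right (hf : ∃ p ∈ IntS Λ.B, HX N f p) (hg : Λ.Z g) : Λ.Z (g * f) := by
  rw [mul_comm]; exact hg.mul_left hf

lemma Z.sum {ι : Type*} (s : Finset ι) {f : ι → ℍ → ℂ} (hf : ∀ i ∈ s, Λ.Z (f i)) :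
    Λ.Z (∑ i ∈ s, f i) := by
  choose! p hp hp' using hf
  refine ⟨_, HX.sum s hp, fun n => ?_⟩
  rw [map_sum]
  exact sum_mem fun i hi => hp' i hi n

lemma Z.sub (hf : Λ.Z f) (hg : Λ.Z g) : Λ.Z (f - g) := by
  obtain ⟨p, hp, hp'⟩ := hf
  obtain ⟨q, hq, hq'⟩ := hg
  exact ⟨p - q, hp.sub hq, fun n => by rw [map_sub]; exact sub_mem (hp' n) (hq' n)⟩

lemma Z_gauss (hN : 1 ≤ N) (hf : ∃ p ∈ IntS Λ.B, HX N f p) (hg : ∃ p ∈ IntS Λ.B, HX N g p)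
    (h : Λ.Z (f * g)) : Λ.Z f ∨ Λ.Z g := by
  obtain ⟨p, hp, hp'⟩ := hf
  obtain ⟨q, hq, hq'⟩ := hg
  rw [Z_iff hN (hp'.mul hq')] at h
  exact (Λ.gauss hp hq h).imp (fun h => ⟨p, hp', h⟩) (fun h => ⟨q, hq', h⟩)

lemma not_Z_one (hN : 1 ≤ N) : ¬ Λ.Z (1 : ℍ → ℂ) := fun h => by
  rw [Z_iff hN HX.one] at h
  have := h 0
  simp at this
  exact Λ.one_W this

lemma not_Z_prod (hN : 1 ≤ N) {ι : Type*} (s : Finset ι) {f : ι → ℍ → ℂ}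
    (hf : ∀ i ∈ s, Lk N Λ.B k (f i)) (h : ∀ i ∈ s, ¬ Λ.Z (f i)) : ¬ Λ.Z (∏ i ∈ s, f i) := by
  classical
  induction s using Finset.induction_on with
  | empty => exact not_Z_one hN
  | insert a s ha ih =>
    rw [Finset.prod_insert ha]
    intro h'
    rcases Z_gauss hN (hf a (by simp)).exp
      (Lk.prod s fun i hi => hf i (by simp [hi])).exp h' with h1 | h1
    · exact h a (by simp) h1
    · exact ih (fun i hi => hf i (by simp [hi])) (fun i hi => h i (by simp [hi])) h1

lemma not_Z_pow (hN : 1 ≤ N) (hf : Lk N Λ.B k f) (h : ¬ Λ.Z f) (n : ℕ) : ¬ Λ.Z (f ^ n) := by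
  have := not_Z_prod hN (Finset.range n) (f := fun _ => f) (fun _ _ => hf) (fun _ _ => h)
  simpa using this

lemma lead_iff {n : ℕ} : Λ.Lead n f ↔ ∃ r ∈ IntS Λ.B, HX N f (PowerSeries.X ^ n * r) ∧
    coeff 0 r ≠ 0 ∧ (coeff 0 r)⁻¹ ∈ Λ.B := by
  constructor
  · rintro ⟨p, hp, hp', h1, h2, h3⟩
    obtain ⟨r, rfl⟩ := PowerSeries.X_pow_dvd_iff.mpr h1
    have : ∀ m, coeff m r = coeff (m + n) (PowerSeries.X ^ n * r) := fun m => by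
      rw [PowerSeries.coeff_X_pow_mul]
    refine ⟨r, fun m => this m ▸ hp _, hp', ?_, ?_⟩
    · rw [this, zero_add]; exact h2
    · rw [this, zero_add]; exact h3
  · rintro ⟨r, hr, h1, h2, h3⟩
    have : coeff n (PowerSeries.X ^ n * r) = coeff 0 r := by
      have := PowerSeries.coeff_X_pow_mul r n 0
      rwa [zero_add] at this
    refine ⟨_, ?_, h1, fun m hm => PowerSeries.X_pow_dvd_iff.mp (Dvd.intro _ rfl) m hm, ?_, ?_⟩
    · refine mul_mem (pow_mem (fun m => ?_) _) hr
      rw [PowerSeries.coeff_X]; split_ifs <;> simp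
    · rwa [this]
    · rwa [this]

lemma Lead.mul {m n : ℕ} (hf : Λ.Lead m f) (hg : Λ.Lead n g) : Λ.Lead (m + n) (f * g) := by
  rw [lead_iff] at *
  obtain ⟨r, hr, h1, h2, h3⟩ := hf
  obtain ⟨s, hs, h4, h5, h6⟩ := hg
  refine ⟨r * s, mul_mem hr hs, ?_, ?_, ?_⟩
  · convert! h1.mul h4 using 1; ring
  · simp at h2 h5 ⊢; exact ⟨h2, h5⟩
  · simp at h3 h6 ⊢; exact mul_mem h6 h3

lemma Lead.one : Λ.Lead 0 (1 : ℍ → ℂ) := by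
  rw [lead_iff]
  exact ⟨1, one_mem _, by simpa using HX.one, by simp, by simp⟩

lemma Lead.pow {m : ℕ} (hf : Λ.Lead m f) (n : ℕ) : Λ.Lead (m * n) (f ^ n) := by
  induction n with
  | zero => simpa using Lead.one
  | succ n ih => rw [pow_succ, Nat.mul_succ]; exact ih.mul hf

lemma Lead.prod {ι : Type*} (s : Finset ι) {f : ι → ℍ → ℂ} (hf : ∀ i ∈ s, ∃ n, Λ.Lead n (f i)) :
    ∃ n, Λ.Lead n (∏ i ∈ s, f i) := by
  classical
  induction s using Finset.induction_on with
  | empty => exact ⟨0, Lead.one⟩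
  | insert a s ha ih =>
    rw [Finset.prod_insert ha]
    obtain ⟨n, hn⟩ := hf a (by simp)
    obtain ⟨m, hm⟩ := ih fun i hi => hf i (by simp [hi])
    exact ⟨_, hn.mul hm⟩

lemma Lead.not_Z (hN : 1 ≤ N) {n : ℕ} (h : Λ.Lead n f) : ¬ Λ.Z f := by
  obtain ⟨p, hp, hp', h1, h2, h3⟩ := h
  rw [Z_iff hN hp']
  exact fun h => Λ.unit_W h3 h2 (h n)

variable (Λ) in
def Dm : Submonoid SL(2, ℤ) where
  carrier := {d | ∀ k f, Lk N Λ.B k f → Λ.Z (sl k f d) → Λ.Z f}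
  one_mem' := fun k f _ h => by rwa [sl_one] at h
  mul_mem' := fun {a b} ha hb k f hf h => ha k f hf (hb k _ (hf.slash a) (by rwa [sl_comp]))

lemma Gamma_Dm {γ : SL(2, ℤ)} (h : γ ∈ CongruenceSubgroup.Gamma N) : γ ∈ Λ.Dm := fun k f hf hz => by
  rwa [hf.1 γ h] at hz

lemma Gamma_fi (hN : 1 ≤ N) : (CongruenceSubgroup.Gamma N).FiniteIndex := by
  have : NeZero N := ⟨by omega⟩
  infer_instance

variable (Λ) in
def D (hN : 1 ≤ N) : Subgroup SL(2, ℤ) where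
  __ := Λ.Dm
  inv_mem' := fun {d} hd => by
    have := Gamma_fi hN
    obtain ⟨n, h1, h2, h3⟩ := Subgroup.exists_pow_mem_of_index_ne_zero this.index_ne_zero d
    have : d⁻¹ = d ^ (n - 1) * (d ^ n)⁻¹ := by
      obtain ⟨m, rfl⟩ : ∃ m, n = m + 1 := ⟨n - 1, by omega⟩
      rw [Nat.add_sub_cancel, pow_succ']; group
    rw [this]
    exact Λ.Dm.mul_mem (Λ.Dm.pow_mem hd _) (Gamma_Dm (inv_mem h3))

lemma mem_D (hN : 1 ≤ N) {d : SL(2, ℤ)} : d ∈ Λ.D hN ↔ ∀ k f, Lk N Λ.B k f → Λ.Z (sl k f d) → Λ.Z f := Iff.rfl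

lemma Gamma_le_D (hN : 1 ≤ N) : CongruenceSubgroup.Gamma N ≤ Λ.D hN := fun _ h => Gamma_Dm h

lemma T_mem_D (hN : 1 ≤ N) : ModularGroup.T ∈ Λ.D hN := fun k f hf hz => by
  obtain ⟨p, hp, hp'⟩ := hf.exp
  rw [Z_iff hN (sl_T hp')] at hz
  refine ⟨p, hp', fun n => ?_⟩
  have := Λ.W_mul (pow_mem (Λ.zeta_inv hN) n) (hz n)
  rwa [PowerSeries.coeff_rescale, ← mul_assoc, ← mul_pow, inv_mul_cancel₀ (zeta_ne N), one_pow, one_mul] at this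

lemma exists_e (hN : 1 ≤ N) (X : Finset SL(2, ℤ)) (hX : ∀ x ∈ X, x ∉ Λ.D hN) :
    ∃ k e, Lk N Λ.B k e ∧ ¬ Λ.Z e ∧ ∀ x ∈ X, Λ.Z (sl k e x) := by
  classical
  induction X using Finset.induction_on with
  | empty => exact ⟨0, 1, ⟨fun γ _ => ModularForm.is_invariant_one γ, fun g => ⟨1, one_mem _, by
      have := ModularForm.is_invariant_one g
      simp only [sl, Nat.cast_zero, this]; exact HX.one⟩⟩, not_Z_one hN, by simp⟩
  | insert a s ha ih =>
    obtain ⟨k, e, h1, h2, h3⟩ := ih fun x hx => hX x (by simp [hx])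
    have h4 := hX a (by simp)
    rw [mem_D] at h4
    push Not at h4
    obtain ⟨l, f, h5, h6, h7⟩ := h4
    refine ⟨k + l, e * f, h1.mul h5, fun h => (Z_gauss hN h1.exp h5.exp h).elim h2 h7, ?_⟩
    intro x hx
    rw [sl_mul]
    rcases Finset.mem_insert.mp hx with rfl | hx
    · exact h6.mul_left (h1.2 _)
    · exact (h3 x hx).mul_right (h5.2 _)

lemma exists_e' (hN : 1 ≤ N) :
    ∃ t e, Lk N Λ.B (12 * t) e ∧ ¬ Λ.Z e ∧ (∀ x, x ∉ Λ.D hN → Λ.Z (sl (12 * t) e x)) ∧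
      ∀ d ∈ Λ.D hN, sl (12 * t) e d = e := by
  classical
  have := Gamma_fi hN
  have : Fintype (SL(2, ℤ) ⧸ CongruenceSubgroup.Gamma N) := Fintype.ofFinite _
  obtain ⟨k, e, h1, h2, h3⟩ := exists_e (Λ := Λ) hN
    ((Finset.univ.image fun q : SL(2, ℤ) ⧸ CongruenceSubgroup.Gamma N => q.out⁻¹).filter (· ∉ Λ.D hN))
    (fun x hx => (Finset.mem_filter.mp hx).2)
  have h4 : ∀ x, x ∉ Λ.D hN → Λ.Z (sl k e x) := fun x hx => by
    obtain ⟨γ, hγ⟩ := QuotientGroup.mk_out_eq_mul (CongruenceSubgroup.Gamma N) x⁻¹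
    have h5 : ((x⁻¹ : SL(2, ℤ)) : SL(2, ℤ) ⧸ CongruenceSubgroup.Gamma N).out⁻¹ = (γ : SL(2, ℤ))⁻¹ * x := by
      rw [hγ]; simp
    have h6 := h3 ((γ : SL(2, ℤ))⁻¹ * x) (by
      refine Finset.mem_filter.mpr ⟨Finset.mem_image.mpr ⟨_, Finset.mem_univ _, h5⟩, fun h => hx ?_⟩
      have := mul_mem (Gamma_le_D (Λ := Λ) hN γ.2) h
      simpa using this)
    rwa [← sl_comp, h1.1 _ (inv_mem γ.2)] at h6
  let H := (CongruenceSubgroup.Gamma N).subgroupOf (Λ.D hN)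
  have : Fintype (Λ.D hN ⧸ H) := Fintype.ofFinite _
  let e1 := ∏ q : Λ.D hN ⧸ H, sl k e (q.out⁻¹ : Λ.D hN)
  have L1 : Lk N Λ.B (k * Fintype.card (Λ.D hN ⧸ H)) e1 := Lk.prod _ fun i _ => h1.slash _
  have Z1 : ¬ Λ.Z e1 := not_Z_prod hN _ (fun i _ => h1.slash _) (fun i _ h =>
    h2 ((i.out⁻¹ : Λ.D hN).2 k e h1 h))
  have S1 : ∀ g, sl (k * Fintype.card (Λ.D hN ⧸ H)) e1 g = ∏ q : Λ.D hN ⧸ H, sl k e ((q.out⁻¹ : Λ.D hN) * g) := by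
    intro g
    have := sl_prod k Finset.univ (fun q : Λ.D hN ⧸ H => sl k e (q.out⁻¹ : Λ.D hN)) g
    rw [Finset.card_univ] at this
    rw [this]
    exact Finset.prod_congr rfl fun i _ => sl_comp ..
  refine ⟨k * Fintype.card (Λ.D hN ⧸ H), e1 ^ 12, by rw [mul_comm]; exact L1.pow 12, not_Z_pow hN L1 Z1 12, ?_, ?_⟩
  · intro x hx
    rw [mul_comm, sl_pow, pow_succ]
    refine Z.mul_left ((L1.slash x).pow 11).exp ?_
    rw [S1, ← Finset.mul_prod_erase _ _ (Finset.mem_univ (((1 : Λ.D hN)) : Λ.D hN ⧸ H))]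
    refine Z.mul_right (Lk.prod (k := k) _ fun i _ => h1.slash _).exp (h4 _ fun h => hx ?_)
    have := mul_mem (inv_mem (SetLike.coe_mem (((1 : Λ.D hN)) : Λ.D hN ⧸ H).out⁻¹)) h
    rwa [inv_mul_cancel_left] at this
  · intro d hd
    rw [mul_comm, sl_pow, S1]
    congr 1
    exact coset_prod H (fun x : Λ.D hN => sl k e x) (fun h hh x => by
      rw [Subgroup.coe_mul, ← sl_comp, h1.1 _ (Subgroup.mem_subgroupOf.mp hh)]) ⟨d, hd⟩

lemma step1 (hN : 1 ≤ N) {ℓ : ℕ} (hl : 2 ≤ ℓ) (hlN : ℓ ∣ N) : ∃ d ∈ Λ.D hN, ¬ (ℓ : ℤ) ∣ d 1 0 := by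
  classical
  by_contra! hcon
  obtain ⟨t, e, he, heZ, heg, hed⟩ := exists_e' (Λ := Λ) hN
  have hl0 : 0 < ℓ := by omega
  set u := uM ℓ hl0
  have hu : Lk N Λ.B 12 u := uM_Lk Λ hN hl0 hlN
  have hul : Λ.Lead (ℓ * N) u := by
    have := uM_lead Λ hN hl0 hlN 1
    rw [sl_one] at this
    convert! this using 1
    obtain ⟨m, rfl⟩ := hlN
    simp [Nat.mul_div_cancel_left m hl0]; ring
  set n := t + 1
  set v := e * u ^ n
  have hv : Lk N Λ.B (12 * t + 12 * n) v := he.mul (hu.pow n)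
  have hvd : ∀ d ∈ Λ.D hN, sl (12 * t + 12 * n) v d = v := fun d hd => by
    rw [sl_mul, sl_pow, hed d hd, uM_inv hl0 d (hcon d hd)]
  have hvg : ∀ x, x ∉ Λ.D hN → Λ.Z (sl (12 * t + 12 * n) v x) := fun x hx => by
    rw [sl_mul]; exact (heg x hx).mul_right ((hu.pow n).2 x)
  have hfi := Gamma_fi hN
  have : (Λ.D hN).FiniteIndex := Subgroup.finiteIndex_of_le (Gamma_le_D hN)
  have : Fintype (SL(2, ℤ) ⧸ Λ.D hN) := Fintype.ofFinite _
  set F := ∑ q : SL(2, ℤ) ⧸ Λ.D hN, sl (12 * t + 12 * n) v q.out⁻¹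
  have hF1 : ∀ g, sl (12 * t + 12 * n) F g = F := fun g => by
    have : sl (12 * t + 12 * n) F g = ∑ q : SL(2, ℤ) ⧸ Λ.D hN, sl (12 * t + 12 * n) v (q.out⁻¹ * g) := by
      rw [sl_sum]; exact Finset.sum_congr rfl fun i _ => sl_comp ..
    rw [this]
    exact coset_sum _ _ (fun h hh x => by rw [← sl_comp, hvd h hh]) g
  have hFv : Λ.Z (F - v) := by
    have h1 : F - v = ∑ q ∈ Finset.univ.erase ((1 : SL(2, ℤ)) : SL(2, ℤ) ⧸ Λ.D hN),
        sl (12 * t + 12 * n) v q.out⁻¹ := by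
      have h2 := Finset.sum_erase_add Finset.univ (fun q : SL(2, ℤ) ⧸ Λ.D hN =>
        sl (12 * t + 12 * n) v q.out⁻¹) (Finset.mem_univ ((1 : SL(2, ℤ)) : SL(2, ℤ) ⧸ Λ.D hN))
      rw [sub_eq_iff_eq_add]
      simp only [hvd _ ((out_mem (Λ.D hN) _).mpr rfl)] at h2
      exact h2.symm
    rw [h1]
    refine Z.sum _ fun q hq => hvg _ fun h => ?_
    exact (Finset.mem_erase.mp hq).1 ((out_mem _ _).mp h)
  obtain ⟨pe, hpe, hpe'⟩ := he.exp
  obtain ⟨r, hr, hr', -, -⟩ := lead_iff.mp (hul.pow n)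
  have hpv : HX N v (pe * (PowerSeries.X ^ (ℓ * N * n) * r)) := hpe'.mul hr'
  obtain ⟨p0, hp0, hp0'⟩ := hFv
  have hpF : HX N F (p0 + pe * (PowerSeries.X ^ (ℓ * N * n) * r)) := by
    have := hp0.add hpv
    rwa [sub_add_cancel] at this
  have hFI : Inv1 (12 * ((t + n : ℕ) : ℤ)) F := fun g => by
    have := hF1 g
    rw [sl] at this
    convert! this using 2
    push_cast; ring
  obtain ⟨hc1, hc2⟩ := HX.contract hN hFI hpF
  have hst := sturm (t + n) F _ hFI hc1 Λ.W (fun m hm => by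
    rw [PowerSeries.coeff_mk, map_add]
    refine add_mem (hp0' _) ?_
    have hdv : (PowerSeries.X : PowerSeries ℂ) ^ (ℓ * N * n) ∣ pe * (PowerSeries.X ^ (ℓ * N * n) * r) :=
      (Dvd.intro _ rfl).mul_left _
    rw [PowerSeries.X_pow_dvd_iff.mp hdv]
    · exact zero_mem _
    · calc N * m < N * (ℓ * n) := Nat.mul_lt_mul_of_pos_left (by
            have : 2 * n ≤ ℓ * n := Nat.mul_le_mul_right _ hl
            omega) (by omega)
        _ = ℓ * N * n := by ring)
  have hZF : Λ.Z F := ⟨_, hpF, fun m => by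
    by_cases hm : N ∣ m
    · obtain ⟨m, rfl⟩ := hm
      have := hst m
      rwa [PowerSeries.coeff_mk] at this
    · rw [hc2 m hm]; exact zero_mem _⟩
  have hZv : Λ.Z v := by
    have := hZF.sub ⟨p0, hp0, hp0'⟩
    rwa [sub_sub_cancel] at this
  rcases Z_gauss hN he.exp (hu.pow n).exp hZv with h | h
  · exact heZ h
  · exact (hul.pow n).not_Z hN h

end Loc
end QP

namespace QP
open PowerSeries (coeff)
open scoped Manifold

lemma conjT (g : SL(2, ℤ)) (m : ℤ) : ((g * ModularGroup.T ^ m * g⁻¹ : SL(2, ℤ)) : Matrix (Fin 2) (Fin 2) ℤ) =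
    !![1 - m * g 0 0 * g 1 0, m * g 0 0 ^ 2; - m * g 1 0 ^ 2, 1 + m * g 0 0 * g 1 0] := by
  have hdet := g.det_coe
  rw [Matrix.det_fin_two] at hdet
  rw [Matrix.SpecialLinearGroup.coe_mul, Matrix.SpecialLinearGroup.coe_mul, ModularGroup.coe_T_zpow,
    Matrix.SpecialLinearGroup.coe_inv, Matrix.adjugate_fin_two]
  ext i j
  fin_cases i <;> fin_cases j <;> simp [Matrix.mul_apply, Fin.sum_univ_two]
  · linear_combination hdet
  · ring
  · ring
  · linear_combination hdet

lemma gamma_of_congr {N : ℕ} {A B : SL(2, ℤ)} (h : ∀ i j, (N : ℤ) ∣ A i j - B i j) :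
    A⁻¹ * B ∈ CongruenceSubgroup.Gamma N := by
  have : Matrix.SpecialLinearGroup.map (Int.castRingHom (ZMod N)) A =
      Matrix.SpecialLinearGroup.map (Int.castRingHom (ZMod N)) B := by
    ext i j
    have := (ZMod.intCast_zmod_eq_zero_iff_dvd _ N).mpr (h i j)
    push_cast at this
    simpa using sub_eq_zero.mp this
  rw [CongruenceSubgroup.Gamma, MonoidHom.mem_ker, map_mul, map_inv, this, inv_mul_cancel]

def Lm : SL(2, ℤ) := ⟨!![1, 0; 1, 1], by simp⟩

namespace Loc
variable {N : ℕ} {Λ : Loc N}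

lemma step2 (hN : 1 ≤ N) (P : Finset ℕ) (hP : ∀ p ∈ P, p.Prime ∧ p ∣ N) :
    ∃ d ∈ Λ.D hN, ∀ p ∈ P, ¬ (p : ℤ) ∣ d 1 0 := by
  classical
  induction P using Finset.induction_on with
  | empty => exact ⟨1, one_mem _, by simp⟩
  | insert ℓ P hℓ ih =>
    obtain ⟨d1, hd1, h1⟩ := ih fun p hp => hP p (by simp [hp])
    by_cases hl : (ℓ : ℤ) ∣ d1 1 0
    swap
    · exact ⟨d1, hd1, fun p hp => (Finset.mem_insert.mp hp).elim (fun h => h ▸ hl) (h1 p)⟩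
    obtain ⟨hlp, hlN⟩ := hP ℓ (by simp)
    obtain ⟨d2, hd2, h2⟩ := step1 (Λ := Λ) hN hlp.two_le hlN
    set M : ℤ := ∏ p ∈ P, (p : ℤ)
    have hlp' : Prime (ℓ : ℤ) := Nat.prime_iff_prime_int.mp hlp
    have hM : ¬ (ℓ : ℤ) ∣ M := by
      intro h
      obtain ⟨p, hp, h⟩ := (Prime.dvd_finsetProd_iff hlp' _).mp h
      have h := (Nat.prime_dvd_prime_iff_eq hlp (hP p (by simp [hp])).1).mp (by exact_mod_cast h)
      exact hℓ (h ▸ hp)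
    refine ⟨d1 * (d2 * ModularGroup.T ^ M * d2⁻¹), mul_mem hd1 (mul_mem (mul_mem hd2 (zpow_mem (T_mem_D hN) _))
      (inv_mem hd2)), fun p hp => ?_⟩
    have hent : (d1 * (d2 * ModularGroup.T ^ M * d2⁻¹)) 1 0 =
      d1 1 0 * (1 - M * d2 0 0 * d2 1 0) + d1 1 1 * (- M * d2 1 0 ^ 2) := by
      rw [Matrix.SpecialLinearGroup.coe_mul, conjT]
      simp [Matrix.mul_apply, Fin.sum_univ_two]
    rw [hent]
    rcases Finset.mem_insert.mp hp with rfl | hp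
    · intro h
      have h3 : (p : ℤ) ∣ d1 1 1 * (- M * d2 1 0 ^ 2) := (dvd_add_right (hl.mul_right _)).mp h
      rcases hlp'.dvd_or_dvd h3 with h4 | h4
      · have hdet := d1.det_coe
        rw [Matrix.det_fin_two] at hdet
        have : (p : ℤ) ∣ 1 := by
          rw [← hdet]; exact dvd_sub (h4.mul_left _) (hl.mul_left _)
        exact hlp'.not_dvd_one this
      · rcases hlp'.dvd_or_dvd h4 with h5 | h5
        · exact hM (by simpa using h5)
        · exact h2 (hlp'.dvd_of_dvd_pow h5)
    · intro h
      have hpM : (p : ℤ) ∣ M := Finset.dvd_prod_of_mem (fun p : ℕ => (p : ℤ)) hp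
      refine h1 p hp ?_
      obtain ⟨m, hm⟩ := hpM
      obtain ⟨y, hy⟩ := h
      rw [hm] at hy
      exact ⟨y + m * (d2 0 0 * d2 1 0 * d1 1 0 + d1 1 1 * d2 1 0 ^ 2), by linear_combination hy⟩

lemma L_mem (hN : 1 ≤ N) : Lm ∈ Λ.D hN := by
  obtain ⟨d, hd, h⟩ := step2 (Λ := Λ) hN N.primeFactors (fun p hp =>
    ⟨Nat.prime_of_mem_primeFactors hp, Nat.dvd_of_mem_primeFactors hp⟩)
  have hcop : IsCoprime (d 1 0) (N : ℤ) := by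
    rw [Int.isCoprime_iff_gcd_eq_one]
    by_contra hc
    obtain ⟨p, hp, hpd⟩ := Nat.exists_prime_and_dvd hc
    have h1 : (p : ℤ) ∣ d 1 0 := (Int.natCast_dvd_natCast.mpr hpd).trans (Int.gcd_dvd_left ..)
    have h2 : (p : ℤ) ∣ N := (Int.natCast_dvd_natCast.mpr hpd).trans (Int.gcd_dvd_right ..)
    exact h p (Nat.mem_primeFactors.mpr ⟨hp, by exact_mod_cast h2, by omega⟩) h1
  obtain ⟨u, v, huv⟩ := hcop
  set g := ModularGroup.T ^ (- d 0 0 * u) * d with hg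
  have hgD : g ∈ Λ.D hN := mul_mem (zpow_mem (T_mem_D hN) _) hd
  have hg10 : g 1 0 = d 1 0 := by
    rw [hg, Matrix.SpecialLinearGroup.coe_mul, ModularGroup.coe_T_zpow]
    simp [Matrix.mul_apply, Fin.sum_univ_two]
  have hg00 : g 0 0 = d 0 0 * v * N := by
    rw [hg, Matrix.SpecialLinearGroup.coe_mul, ModularGroup.coe_T_zpow]
    simp [Matrix.mul_apply, Fin.sum_univ_two]
    linear_combination (- d 0 0) * huv
  have hA : g * ModularGroup.T ^ (-u ^ 2) * g⁻¹ ∈ Λ.D hN :=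
    mul_mem (mul_mem hgD (zpow_mem (T_mem_D hN) _)) (inv_mem hgD)
  have hc := gamma_of_congr (N := N) (A := g * ModularGroup.T ^ (-u ^ 2) * g⁻¹) (B := Lm) (by
    intro i j
    rw [conjT, hg10, hg00, Lm]
    fin_cases i <;> fin_cases j <;> simp
    · exact ⟨u ^ 2 * (d 0 0 * v) * d 1 0, by ring⟩
    · exact ⟨u ^ 2 * d 0 0 ^ 2 * v ^ 2 * N, by ring⟩
    · exact ⟨- v * (u * d 1 0 + 1), by linear_combination (u * d 1 0 + 1) * huv⟩
    · exact ⟨u ^ 2 * d 0 0 * v * d 1 0, by ring⟩)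
  have := mul_mem hA (Gamma_le_D (Λ := Λ) hN hc)
  rwa [mul_inv_cancel_left] at this

lemma D_top (hN : 1 ≤ N) : Λ.D hN = ⊤ := by
  have hT := T_mem_D (Λ := Λ) hN
  have hS : ModularGroup.S ∈ Λ.D hN := by
    have : ModularGroup.S = ModularGroup.T⁻¹ * Lm * ModularGroup.T⁻¹ := by
      decide +kernel
    rw [this]
    exact mul_mem (mul_mem (inv_mem hT) (L_mem hN)) (inv_mem hT)
  rw [eq_top_iff, ← SpecialLinearGroup.SL2Z_generators, Subgroup.closure_le]
  rintro x (rfl | rfl)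
  · exact hS
  · exact hT

lemma claimP (hN : 1 ≤ N) {k : ℕ} {f : ℍ → ℂ} (hf : Lk N Λ.B k f) {d : SL(2, ℤ)}
    (h : Λ.Z f) : Λ.Z (sl k f d) := by
  have : d⁻¹ ∈ Λ.D hN := by rw [D_top]; trivial
  refine (mem_D hN).mp this k _ (hf.slash d) ?_
  rwa [sl_comp, mul_inv_cancel, sl_one]

/-- the consequence: bounded denominators + integral at infinity ⇒ integral -/
lemma claimP' (hN : 1 ≤ N) {k : ℕ} {f : ℍ → ℂ} (m : ℕ) (hf : Lk N Λ.B k (Λ.w ^ m • f))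
    (h : ∃ p ∈ IntS Λ.B, HX N f p) : Lk N Λ.B k f := by
  induction m with
  | zero => simpa using hf
  | succ m ih =>
    refine ih ?_
    have hw := Λ.w_ne
    have key : Λ.Z (Λ.w ^ (m + 1) • f) := by
      obtain ⟨p, hp, hp'⟩ := h
      refine ⟨_, hp'.smul _, fun n => ?_⟩
      rw [map_smul]
      exact ⟨Λ.w ^ m * coeff n p, mul_mem (pow_mem Λ.w_mem _) (hp n), by simp; ring⟩
    have e : Λ.w ^ m • f = Λ.w⁻¹ • (Λ.w ^ (m + 1) • f) := by
      rw [smul_smul, pow_succ']; congr 1; field_simp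
    refine ⟨fun γ hγ => ?_, fun g => ?_⟩
    · rw [e, sl_smul, hf.1 γ hγ]
    · obtain ⟨p, hp, hZ⟩ := claimP hN hf (d := g) key
      rw [e, sl_smul]
      refine ⟨_, fun n => ?_, hp.smul _⟩
      obtain ⟨b, hb, hb'⟩ := hZ n
      rw [map_smul, hb', smul_eq_mul, inv_mul_cancel_left₀ hw]
      exact hb

end Loc
end QP

namespace QP
open PowerSeries (coeff)
open scoped Manifold

open EisensteinSeries in
open Classical in
def GE (N : ℕ) (v : Fin 2 → ℤ) (τ : ℍ) : ℂ :=
  ∑' x : Fin 2 → ℤ, if ∀ i, (N : ℤ) ∣ x i - v i then eisSummand 3 x τ else 0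

def slE (g : SL(2, ℤ)) : (Fin 2 → ℤ) ≃ (Fin 2 → ℤ) where
  toFun x := Matrix.vecMul x g.1
  invFun x := Matrix.vecMul x (g⁻¹).1
  left_inv x := by
    simp only [Matrix.vecMul_vecMul, ← Matrix.SpecialLinearGroup.coe_mul]; simp
  right_inv x := by
    simp only [Matrix.vecMul_vecMul, ← Matrix.SpecialLinearGroup.coe_mul]; simp

lemma cong_vecMul {N : ℕ} {x v : Fin 2 → ℤ} (A : Matrix (Fin 2) (Fin 2) ℤ)
    (h : ∀ i, (N : ℤ) ∣ x i - v i) (i : Fin 2) : (N : ℤ) ∣ Matrix.vecMul x A i - Matrix.vecMul v A i := by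
  rw [← Pi.sub_apply, ← Matrix.sub_vecMul]
  simp only [Matrix.vecMul, dotProduct]
  exact Finset.dvd_sum fun j _ => (h j).mul_right _

lemma GE_slash (N : ℕ) (v : Fin 2 → ℤ) (g : SL(2, ℤ)) :
    sl 3 (GE N v) g = GE N (Matrix.vecMul v g.1) := by
  classical
  funext τ
  rw [sl_apply, GE, GE, ← tsum_mul_right]
  conv_rhs => rw [← (slE g).tsum_eq]
  refine tsum_congr fun x => ?_
  have hiff : (∀ i, (N : ℤ) ∣ slE g x i - Matrix.vecMul v g.1 i) ↔ ∀ i, (N : ℤ) ∣ x i - v i := by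
    constructor
    · intro h
      have := cong_vecMul (g⁻¹).1 h
      have e1 : Matrix.vecMul (slE g x) (g⁻¹).1 = x := (slE g).left_inv x
      have e2 : Matrix.vecMul (Matrix.vecMul v g.1) (g⁻¹).1 = v := (slE g).left_inv v
      rwa [e1, e2] at this
    · exact fun h => cong_vecMul g.1 h
  by_cases hc : ∀ i, (N : ℤ) ∣ x i - v i
  · rw [if_pos hc, if_pos (hiff.mpr hc)]
    rw [EisensteinSeries.eisSummand_SL2_apply, ModularGroup.denom_apply]
    have := cden_ne g τ
    rw [mul_comm, ← mul_assoc, zpow_neg]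
    simp only [Nat.cast_ofNat]
    rw [inv_mul_cancel₀ (zpow_ne_zero _ this), one_mul]
    rfl
  · rw [if_neg hc, if_neg fun h => hc (hiff.mp h), zero_mul]

lemma GE_congr {N : ℕ} {v v' : Fin 2 → ℤ} (h : ∀ i, (N : ℤ) ∣ v i - v' i) : GE N v = GE N v' := by
  classical
  funext τ
  rw [GE, GE]
  refine tsum_congr fun x => ?_
  have : (∀ i, (N : ℤ) ∣ x i - v i) ↔ ∀ i, (N : ℤ) ∣ x i - v' i := by
    refine forall_congr' fun i => ?_
    have : x i - v' i = (x i - v i) + (v i - v' i) := by ring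
    rw [this]
    exact (dvd_add_left (h i)).symm
  simp only [this]

open Classical in
def Row (N : ℕ) (b m : ℤ) (τ : ℍ) : ℂ :=
  ∑' n : ℤ, if (N : ℤ) ∣ n - b then ((m : ℂ) * τ + n) ^ (-3 : ℤ) else 0

open Classical in
lemma GE_rows (N : ℕ) (v : Fin 2 → ℤ) (τ : ℍ) :
    Summable (fun m : ℤ => if (N : ℤ) ∣ m - v 0 then Row N (v 1) m τ else 0) ∧ 
    GE N v τ = ∑' m : ℤ, if (N : ℤ) ∣ m - v 0 then Row N (v 1) m τ else 0 := by
  have hs : Summable fun x : ℤ × ℤ => if (N : ℤ) ∣ x.1 - v 0 ∧ (N : ℤ) ∣ x.2 - v 1 then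
      EisensteinSeries.eisSummand 3 ![x.1, x.2] τ else 0 := by
    have h1 := (summable_prod_eisSummand (k := 3) le_rfl τ).norm
    refine Summable.of_norm_bounded h1 fun x => ?_
    split_ifs
    · exact le_rfl
    · simp
  have h2 : ∀ m : ℤ, ∑' n : ℤ, (if (N : ℤ) ∣ m - v 0 ∧ (N : ℤ) ∣ n - v 1 then
      EisensteinSeries.eisSummand 3 ![m, n] τ else 0) = if (N : ℤ) ∣ m - v 0 then Row N (v 1) m τ else 0 := by
    intro m
    by_cases hm : (N : ℤ) ∣ m - v 0
    · simp only [hm, true_and, if_true, Row]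
      rfl
    · simp [hm]
  constructor
  · exact hs.prod.congr h2
  · rw [GE, ← (finTwoArrowEquiv ℤ).symm.tsum_eq]
    simp only [finTwoArrowEquiv_symm_apply, Fin.forall_fin_two]
    refine (Eq.trans ?_ (hs.tsum_prod)).trans (tsum_congr h2)
    rfl

def CE (N : ℕ) : ℂ := (N : ℂ) ^ 3 * 2 / (-2 * π * Complex.I) ^ 3

lemma row_pos {N : ℕ} (hN : 1 ≤ N) (b : ℤ) (m : ℕ+) (τ : ℍ) :
    CE N * Row N b m τ = ∑' d : ℕ+, (d : ℂ) ^ 2 * zetaC N ^ (b * d) * qn N τ ^ (m * d : ℕ) := by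
  classical
  have hN' : (N : ℂ) ≠ 0 := by exact_mod_cast (by omega : N ≠ 0)
  have hpi : (-2 * π * Complex.I : ℂ) ≠ 0 := by simp [Real.pi_ne_zero]
  have h1 : Row N b m τ = ∑' j : ℤ, ((N : ℂ) ^ 3)⁻¹ * (1 / ((pt m N m.pos hN b τ : ℂ) + j) ^ (2 + 1)) := by
    have hi : Function.Injective (fun j : ℤ => b + N * j) := fun x y h => by
      have hN2 : (N : ℤ) ≠ 0 := by exact_mod_cast (by omega : N ≠ 0)
      simp only [add_right_inj] at h
      exact mul_left_cancel₀ hN2 h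
    rw [Row, ← hi.tsum_eq]
    · refine tsum_congr fun j => ?_
      rw [if_pos ⟨j, by ring⟩, pt_coe, zpow_neg]
      have : (((m : ℕ) : ℂ) * τ + b) / N + j = (((m : ℕ) : ℤ) * (τ : ℂ) + ((b + N * j : ℤ) : ℂ)) / N := by
        push_cast; field_simp; ring
      rw [this, div_pow, one_div_div]
      norm_cast
      field_simp
    · intro n hn
      by_cases h : (N : ℤ) ∣ n - b
      · obtain ⟨j, hj⟩ := h
        exact ⟨j, by simp only; omega⟩
      · simp [h] at hn
  rw [h1, tsum_mul_left, EisensteinSeries.qExpansion_identity_pnat (by norm_num : 1 ≤ 2), CE, ← mul_assoc,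
    ← mul_assoc]
  have h2 : (N : ℂ) ^ 3 * 2 / (-2 * π * Complex.I) ^ 3 * ((N : ℂ) ^ 3)⁻¹ * ((-2 * π * Complex.I) ^ (2 + 1) / (Nat.factorial 2 : ℕ)) = 1 := by
    have h3 : ((-2 * π * Complex.I : ℂ)) ^ 3 ≠ 0 := pow_ne_zero _ hpi
    simp only [Nat.factorial]
    generalize (-2 * π * Complex.I : ℂ) = z at *
    field_simp
    push_cast
    ring
  rw [h2, one_mul]
  refine tsum_congr fun d => ?_
  conv_rhs => rw [mul_assoc]
  congr 1
  rw [pt_coe, zetaC, qn, ← Complex.exp_nat_mul, ← Complex.exp_int_mul, ← Complex.exp_nat_mul, ← Complex.exp_add]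
  congr 1
  push_cast
  field_simp
  ring

lemma row_neg (N : ℕ) (b m : ℤ) (τ : ℍ) : Row N b (-m) τ = - Row N (-b) m τ := by
  classical
  rw [Row, Row, ← tsum_neg, ← (Equiv.neg ℤ).tsum_eq]
  refine tsum_congr fun n => ?_
  have : ((N : ℤ) ∣ (Equiv.neg ℤ) n - b) ↔ (N : ℤ) ∣ n - -b := by
    rw [← dvd_neg]; simp [add_comm]
  simp only [this]
  split_ifs
  · have : (((-m : ℤ) : ℂ) * τ + ((Equiv.neg ℤ n : ℤ) : ℂ)) = - ((m : ℂ) * τ + n) := by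
      simp; ring
    rw [this, zpow_neg, zpow_neg]
    norm_cast
    rw [Odd.neg_pow (by decide), inv_neg]
  · simp

open Classical in
def AE (N : ℕ) (v : Fin 2 → ℤ) (i : ℕ+ × ℕ+) : ℂ :=
  (i.2 : ℂ) ^ 2 * ((if (N : ℤ) ∣ i.1 - v 0 then zetaC N ^ (v 1 * i.2) else 0) -
    if (N : ℤ) ∣ -i.1 - v 0 then zetaC N ^ (- v 1 * i.2) else 0)

lemma norm_zeta {N : ℕ} (hN : 1 ≤ N) : ‖zetaC N‖ = 1 := (zeta_prim hN).norm'_eq_one (by omega)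

lemma AE_part_summable {N : ℕ} (hN : 1 ≤ N) (τ : ℍ) (P : ℕ+ → Prop) [DecidablePred P] (b : ℤ) :
    Summable fun i : ℕ+ × ℕ+ => if P i.1 then (i.2 : ℂ) ^ 2 * zetaC N ^ (b * i.2) * qn N τ ^ (i.1 * i.2 : ℕ) else 0 := by
  have := (summable_prod_mul_pow (𝕜 := ℂ) 2 (r := qn N τ) (qn_lt hN τ)).norm
  refine Summable.of_norm_bounded this fun i => ?_
  split_ifs
  · rw [norm_mul, norm_mul, norm_zpow, norm_zeta hN, norm_mul]; simp
  · simp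

open Classical in
def c0 (N : ℕ) (v : Fin 2 → ℤ) : ℂ := if (N : ℤ) ∣ v 0 then CE N * ∑' n : ℤ, (if (N : ℤ) ∣ n - v 1 then (n : ℂ) ^ (-3 : ℤ) else 0) else 0

lemma GE_hasSum {N : ℕ} (hN : 1 ≤ N) (v : Fin 2 → ℤ) (τ : ℍ) :
    HasSum (fun i : ℕ+ × ℕ+ => AE N v i * qn N τ ^ (i.1 * i.2 : ℕ)) (CE N * GE N v τ - c0 N v) := by
  classical
  obtain ⟨hs, he⟩ := GE_rows N v τ
  have hA := AE_part_summable hN τ (fun m => (N : ℤ) ∣ m - v 0) (v 1)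
  have hB := AE_part_summable hN τ (fun m => (N : ℤ) ∣ -m - v 0) (- v 1)
  have h1 : CE N * GE N v τ - c0 N v =
     (∑' i : ℕ+ × ℕ+, if (N : ℤ) ∣ i.1 - v 0 then (i.2 : ℂ) ^ 2 * zetaC N ^ (v 1 * i.2) * qn N τ ^ (i.1 * i.2 : ℕ) else 0)
     - ∑' i : ℕ+ × ℕ+, if (N : ℤ) ∣ -i.1 - v 0 then (i.2 : ℂ) ^ 2 * zetaC N ^ (-v 1 * i.2) * qn N τ ^ (i.1 * i.2 : ℕ) else 0 := by
    rw [he, tsum_int_eq_zero_add_tsum_pnat hs, hA.tsum_prod, hB.tsum_prod, mul_add, mul_add, ← tsum_mul_left,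
      ← tsum_mul_left]
    have e0 : CE N * (if (N : ℤ) ∣ 0 - v 0 then Row N (v 1) 0 τ else 0) = c0 N v := by
      simp [c0, Row]
    have e1 : ∀ m : ℕ+, CE N * (if (N : ℤ) ∣ m - v 0 then Row N (v 1) m τ else 0) = 
       ∑' d : ℕ+, if (N : ℤ) ∣ m - v 0 then (d : ℂ) ^ 2 * zetaC N ^ (v 1 * d) * qn N τ ^ (m * d : ℕ) else 0 := by
      intro m
      split_ifs
      · exact row_pos hN _ _ _
      · simp
    have e2 : ∀ m : ℕ+, CE N * (if (N : ℤ) ∣ -m - v 0 then Row N (v 1) (-m) τ else 0) = 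
       - ∑' d : ℕ+, if (N : ℤ) ∣ -m - v 0 then (d : ℂ) ^ 2 * zetaC N ^ (-v 1 * d) * qn N τ ^ (m * d : ℕ) else 0 := by
      intro m
      split_ifs
      · rw [row_neg, mul_neg, row_pos hN]
      · simp
    rw [e0, tsum_congr e1, tsum_congr e2, tsum_neg]
    ring
  rw [h1]
  refine (hA.hasSum.sub hB.hasSum).congr_fun fun i => ?_
  rw [AE]
  split_ifs <;> ring

def PE (N : ℕ) (v : Fin 2 → ℤ) : PowerSeries ℂ :=
  PowerSeries.mk fun n => ∑' i : (fun i : ℕ+ × ℕ+ => (i.1 * i.2 : ℕ)) ⁻¹' {n}, AE N v i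

lemma PE_HX {N : ℕ} (hN : 1 ≤ N) (v : Fin 2 → ℤ) :
    HX N (CE N • GE N v) (c0 N v • (1 : PowerSeries ℂ) + PE N v) := by
  have h := HX_of_fiber (N := N) (AE N v) (fun i => (i.1 * i.2 : ℕ)) (f := fun τ => CE N * GE N v τ - c0 N v)
    (fun τ => GE_hasSum hN v τ)
  have h2 := ((HX.one (N := N)).smul (c0 N v)).add h
  convert! h2 using 1
  funext τ
  simp

lemma fiber_fin (n : ℕ) : ((fun i : ℕ+ × ℕ+ => (i.1 * i.2 : ℕ)) ⁻¹' {n}).Finite := by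
  have hi : Function.Injective (fun i : ℕ+ × ℕ+ => ((i.1 : ℕ), (i.2 : ℕ))) := fun a b h => by
    simp only [Prod.mk.injEq, PNat.coe_inj] at h
    exact Prod.ext h.1 h.2
  refine ((Finset.finite_toSet (Finset.Icc 0 n ×ˢ Finset.Icc 0 n)).preimage hi.injOn).subset ?_
  intro i hx
  have h : (i.1 * i.2 : ℕ) = n := hx
  have h1 : (i.1 : ℕ) ≤ n := h ▸ Nat.le_mul_of_pos_right _ i.2.pos
  have h2 : (i.2 : ℕ) ≤ n := h ▸ Nat.le_mul_of_pos_left _ i.1.pos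
  simpa using ⟨h1, h2⟩

lemma PE_IntS {N : ℕ} (hN : 1 ≤ N) (Λ : Loc N) (v : Fin 2 → ℤ) : PE N v ∈ IntS Λ.B := fun n => by
  have := (fiber_fin n).fintype
  rw [PE, PowerSeries.coeff_mk, tsum_fintype]
  refine sum_mem fun i _ => ?_
  rw [AE]
  refine mul_mem (pow_mem (natCast_mem _ _) _) (sub_mem ?_ ?_)
  · split_ifs
    · exact Λ.zeta_zpow hN _
    · exact zero_mem _
  · split_ifs
    · exact Λ.zeta_zpow hN _
    · exact zero_mem _

lemma PE_zero (N : ℕ) (v : Fin 2 → ℤ) : coeff 0 (PE N v) = 0 := by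
  rw [PE, PowerSeries.coeff_mk]
  have : IsEmpty ((fun i : ℕ+ × ℕ+ => (i.1 * i.2 : ℕ)) ⁻¹' {0}) := ⟨fun i => by
    have : (i.1.1 * i.1.2 : ℕ) = 0 := i.2
    simp at this⟩
  exact tsum_empty

lemma PE_one (N : ℕ) (v : Fin 2 → ℤ) : coeff 1 (PE N v) = AE N v (1, 1) := by
  rw [PE, PowerSeries.coeff_mk]
  have : (fun i : ℕ+ × ℕ+ => (i.1 * i.2 : ℕ)) ⁻¹' {1} = {(1, 1)} := by
    ext i
    simp [Prod.ext_iff]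
  rw [this, tsum_singleton]

end QP

namespace QP
open PowerSeries (coeff)
open scoped Manifold

lemma zeta_zpow_eq_one {N : ℕ} (hN : 1 ≤ N) (n : ℤ) : zetaC N ^ n = 1 ↔ (N : ℤ) ∣ n :=
  (zeta_prim hN).zpow_eq_one_iff_dvd n

open Classical in
lemma orth {N : ℕ} (hN : 1 ≤ N) (n : ℤ) :
    (if (N : ℤ) ∣ n then (1 : ℂ) else 0) = (N : ℂ)⁻¹ * ∑ j ∈ Finset.range N, zetaC N ^ (j * n) := by
  have hN' : (N : ℂ) ≠ 0 := by exact_mod_cast (by omega : N ≠ 0)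
  have e : ∀ j : ℕ, zetaC N ^ (j * n) = (zetaC N ^ n) ^ j := fun j => by
    rw [mul_comm, zpow_mul, zpow_natCast]
  simp only [e]
  split_ifs with h
  · rw [(zeta_zpow_eq_one hN n).mpr h]; simp [hN']
  · have h1 : zetaC N ^ n - 1 ≠ 0 := sub_ne_zero.mpr fun h' => h ((zeta_zpow_eq_one hN n).mp h')
    have h2 := geom_sum_mul (zetaC N ^ n) N
    rw [← zpow_natCast, ← zpow_mul, mul_comm n, zpow_mul, (zeta_zpow_eq_one hN N).mpr dvd_rfl, one_zpow, sub_self] at h2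
    rw [(mul_eq_zero.mp h2).resolve_right h1, mul_zero]

lemma bern3 (x : ℝ) : bernoulliFun 3 x = x ^ 3 - 3 / 2 * x ^ 2 + x / 2 := by
  rw [bernoulliFun, Polynomial.bernoulli]
  simp [Finset.sum_range_succ, bernoulli, bernoulli'_one, bernoulli'_two, bernoulli'_three]
  norm_num [Nat.choose]
  try ring

lemma c0_eq {N : ℕ} (hN : 1 ≤ N) (b : ℤ) : by
    classical exact (6 * N : ℂ) * (CE N * ∑' n : ℤ, (if (N : ℤ) ∣ n - b then (n : ℂ) ^ (-3 : ℤ) else 0)) = 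
    ∑ j ∈ Finset.range N, zetaC N ^ (- (j * b)) * (2 * j ^ 3 - 3 * N * j ^ 2 + N ^ 2 * j) := by
  classical
  have hN' : (N : ℂ) ≠ 0 := by exact_mod_cast (by omega : N ≠ 0)
  have hN2 : (N : ℝ) ≠ 0 := by exact_mod_cast (by omega : N ≠ 0)
  have hpi : (-2 * π * Complex.I : ℂ) ≠ 0 := by simp [Real.pi_ne_zero]
  have h1 : ∀ j ∈ Finset.range N, HasSum (fun n : ℤ => 1 / (n : ℂ) ^ 3 * zetaC N ^ (j * n)) 
      (-(2 * π * Complex.I) ^ 3 / 6 * ((j / N : ℂ) ^ 3 - 3 / 2 * (j / N : ℂ) ^ 2 + (j / N : ℂ) / 2)) := by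
    intro j hj
    have hx : (j / N : ℝ) ∈ Set.Icc (0 : ℝ) 1 := by
      refine ⟨by positivity, ?_⟩
      rw [div_le_one (by positivity)]
      exact_mod_cast (Finset.mem_range.mp hj).le
    have h := hasSum_one_div_pow_mul_fourier_mul_bernoulliFun (k := 3) (by norm_num) hx
    rw [bern3] at h
    convert! h using 1
    · funext n
      rw [fourier_coe_apply, zetaC, ← Complex.exp_int_mul]
      congr 2
      push_cast
      field_simp
    · simp [Nat.factorial]
  have h2 := hasSum_sum fun j hj => (h1 j hj).mul_left (zetaC N ^ (-(j * b)))
  have h3 := h2.mul_left (N : ℂ)⁻¹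
  have h4 : ∀ n : ℤ, (if (N : ℤ) ∣ n - b then (n : ℂ) ^ (-3 : ℤ) else 0) = (N : ℂ)⁻¹ * ∑ j ∈ Finset.range N,
      zetaC N ^ (-(j * b)) * (1 / (n : ℂ) ^ 3 * zetaC N ^ (j * n)) := by
    intro n
    have := orth hN (n - b)
    have h5 : (if (N : ℤ) ∣ n - b then (n : ℂ) ^ (-3 : ℤ) else 0) = (if (N : ℤ) ∣ n - b then 1 else 0) * (n : ℂ) ^ (-3 : ℤ) := by
      split_ifs <;> simp
    rw [h5, this, mul_assoc, Finset.sum_mul]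
    congr 1
    refine Finset.sum_congr rfl fun j _ => ?_
    have h7 : (n : ℂ) ^ (-3 : ℤ) = 1 / (n : ℂ) ^ 3 := by
      rw [zpow_neg, one_div]; norm_cast
    rw [mul_sub, sub_eq_add_neg, zpow_add₀ (zeta_ne N), h7]
    ring
  rw [tsum_congr h4, h3.tsum_eq, CE, Finset.mul_sum, Finset.mul_sum, Finset.mul_sum]
  refine Finset.sum_congr rfl fun j _ => ?_
  have h6 : (2 * π * Complex.I : ℂ) ^ 3 = - (-2 * π * Complex.I) ^ 3 := by ring
  rw [h6]
  generalize (-2 * π * Complex.I : ℂ) = z at *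
  field_simp

lemma Loc.decomp {N : ℕ} (Λ : Loc N) {x : ℂ} (hx : x ∈ Λ.B) (h0 : x ≠ 0) :
    ∃ m u, u ∈ Λ.B ∧ u⁻¹ ∈ Λ.B ∧ u ≠ 0 ∧ x = Λ.w ^ m * u := by
  classical
  by_contra! hc
  refine h0 (Λ.sep x fun n => ?_)
  induction n with
  | zero => exact ⟨x, hx, by simp⟩
  | succ n ih =>
    obtain ⟨b, hb, e⟩ := ih
    have hb0 : b ≠ 0 := fun h => h0 (by rw [e, h, mul_zero])
    rcases Λ.dich b hb with ⟨c, hc', e'⟩ | h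
    · exact ⟨c, hc', by rw [e, e']; ring⟩
    · exact absurd e (hc n b hb h hb0)

lemma Loc.c0_mem {N : ℕ} (hN : 1 ≤ N) (Λ : Loc N) : ∃ m, ∀ v, Λ.w ^ m * c0 N v ∈ Λ.B := by
  obtain ⟨m, u, hu, hui, hu0, e⟩ := Λ.decomp (x := 6) (by exact_mod_cast natCast_mem Λ.B 6) (by norm_num)
  refine ⟨m, fun v => ?_⟩
  rw [c0]
  split_ifs
  · have h := c0_eq hN (v 1)
    set X := (CE N * ∑' n : ℤ, (if (N : ℤ) ∣ n - v 1 then (n : ℂ) ^ (-3 : ℤ) else 0)) with hX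
    have hN' : (N : ℂ) ≠ 0 := by exact_mod_cast (by omega : N ≠ 0)
    have h2 : Λ.w ^ m * X = u⁻¹ * (N : ℂ)⁻¹ * ((6 * N) * X) := by
      rw [e]; field_simp
    rw [h2]
    refine mul_mem (mul_mem hui Λ.Ninv) ?_
    convert! (?_ : ∑ j ∈ Finset.range N, zetaC N ^ (- (j * v 1)) * (2 * j ^ 3 - 3 * N * j ^ 2 + N ^ 2 * j : ℂ) ∈ Λ.B) using 1
    refine sum_mem fun j _ => mul_mem (Λ.zeta_zpow hN _) ?_
    have : (2 * j ^ 3 - 3 * N * j ^ 2 + N ^ 2 * j : ℂ) = ((2 * j ^ 3 - 3 * N * j ^ 2 + N ^ 2 * j : ℤ) : ℂ) := by push_cast; ring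
    rw [this]
    exact intCast_mem _ _
  · simp

/-- the weight three Eisenstein series -/
def psi (N : ℕ) : ℍ → ℂ := CE N • GE N ![1, 0]

lemma psi_sl (N : ℕ) (h : SL(2, ℤ)) : sl 3 (psi N) h = CE N • GE N ![h 0 0, h 0 1] := by
  rw [psi, sl_smul, GE_slash]
  congr 2
  funext i
  fin_cases i <;> simp [Matrix.vecMul, dotProduct, Fin.sum_univ_two]

lemma psi_Lk {N : ℕ} (hN : 3 ≤ N) (Λ : Loc N) : Lk N Λ.B 3 (psi N) := by
  obtain ⟨m, hm⟩ := Λ.c0_mem (by omega)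
  have hG : GInv N 3 (psi N) := fun γ hγ => by
    rw [psi_sl, psi]
    congr 1
    refine GE_congr ?_
    rw [CongruenceSubgroup.Gamma_mem] at hγ
    rw [Fin.forall_fin_two]
    constructor
    · have := hγ.1
      rw [← sub_eq_zero] at this
      rw [← ZMod.intCast_zmod_eq_zero_iff_dvd]
      push_cast
      simpa using this
    · have := hγ.2.1
      rw [← ZMod.intCast_zmod_eq_zero_iff_dvd]
      push_cast
      simpa using this
  refine Λ.claimP' (by omega) m ⟨fun γ h => by rw [sl_smul, hG γ h], fun g => ?_⟩ ?_
  · rw [sl_smul, psi_sl]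
    refine ⟨_, ?_, (PE_HX (by omega) _).smul _⟩
    rw [smul_add, smul_smul]
    exact add_mem (smul_IntS (hm _) (one_mem _)) (smul_IntS (pow_mem Λ.w_mem _) (PE_IntS (by omega) _ _))
  · refine ⟨_, ?_, PE_HX (by omega) _⟩
    refine add_mem ?_ (PE_IntS (by omega) _ _)
    have : c0 N ![1, 0] = 0 := by
      rw [c0, if_neg]
      simp only [Matrix.cons_val_zero]
      intro h
      have := Int.eq_one_of_dvd_one (by omega) h
      omega
    rw [this, zero_smul]
    exact zero_mem _

/-- expansion of `psi | h` for `h` lower left zero mod N -/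
lemma psi_low {N : ℕ} (hN : 3 ≤ N) (Λ : Loc N) (h : SL(2, ℤ)) (hx : ¬ (N : ℤ) ∣ h 0 0) :
    ∃ p ∈ IntS Λ.B, HX N (sl 3 (psi N) h) p ∧ coeff 0 p = 0 ∧ coeff 1 p = AE N ![h 0 0, h 0 1] (1, 1) := by
  have : c0 N ![h 0 0, h 0 1] = 0 := by
    rw [c0, if_neg]
    simpa using hx
  have h1 := PE_HX (N := N) (by omega) ![h 0 0, h 0 1]
  rw [this, zero_smul, zero_add, ← psi_sl] at h1
  exact ⟨_, PE_IntS (by omega) _ _, h1, PE_zero _ _, PE_one _ _⟩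

end QP

namespace QP
open PowerSeries (coeff)
open scoped Manifold

lemma sl_T_pow {N : ℕ} {k : ℕ} {f : ℍ → ℂ} {p : PowerSeries ℂ} (h : HX N f p) (n : ℕ) :
    HX N (sl k f (ModularGroup.T ^ n)) (PowerSeries.rescale (zetaC N ^ n) p) := by
  induction n with
  | zero => simpa [sl_one] using h
  | succ n ih =>
    rw [pow_succ, ← sl_comp]
    convert! sl_T (k := k) ih using 1
    rw [PowerSeries.rescale_rescale, pow_succ]

lemma sum_aux (z : ℂ) (n : ℕ) : (∑ j ∈ Finset.range n, j * z ^ j) * (z - 1) = n * z ^ n - z * ∑ j ∈ Finset.range n, z ^ j := by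
  induction n with
  | zero => simp
  | succ n ih => rw [Finset.sum_range_succ, Finset.sum_range_succ, add_mul, ih]; push_cast; ring

lemma Loc.zeta_sub {N : ℕ} (hN : 1 ≤ N) (Λ : Loc N) {n : ℕ} (hn : ¬ N ∣ n) :
    zetaC N ^ n - 1 ≠ 0 ∧ (zetaC N ^ n - 1)⁻¹ ∈ Λ.B := by
  have hN' : (N : ℂ) ≠ 0 := by exact_mod_cast (by omega : N ≠ 0)
  have h1 : zetaC N ^ n - 1 ≠ 0 := by
    rw [sub_ne_zero]
    intro h
    exact hn ((zeta_prim hN).dvd_of_pow_eq_one n h)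
  have h2 : (zetaC N ^ n) ^ N = 1 := by rw [← pow_mul, mul_comm, pow_mul, (zeta_prim hN).pow_eq_one, one_pow]
  have h3 : ∑ j ∈ Finset.range N, (zetaC N ^ n) ^ j = 0 := by
    have := geom_sum_mul (zetaC N ^ n) N
    rw [h2, sub_self] at this
    exact (mul_eq_zero.mp this).resolve_right h1
  have h4 := sum_aux (zetaC N ^ n) N
  rw [h2, h3, mul_one, mul_zero, sub_zero] at h4
  refine ⟨h1, ?_⟩
  have : (zetaC N ^ n - 1)⁻¹ = (N : ℂ)⁻¹ * ∑ j ∈ Finset.range N, j * (zetaC N ^ n) ^ j := by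
    refine inv_eq_of_mul_eq_one_left ?_
    rw [mul_assoc, h4, inv_mul_cancel₀ hN']
  rw [this]
  exact mul_mem Λ.Ninv (sum_mem fun j _ => mul_mem (natCast_mem _ _) (pow_mem (pow_mem Λ.zeta _) _))

namespace Loc
variable {N : ℕ} {Λ : Loc N} {k l : ℕ} {f g : ℍ → ℂ} {p : PowerSeries ℂ}

lemma Lead.neg {n : ℕ} (h : Λ.Lead n f) : Λ.Lead n (-f) := by
  obtain ⟨p, hp, hp', h1, h2, h3⟩ := h
  refine ⟨-p, neg_mem hp, hp'.neg, fun m hm => by simp [h1 m hm], by simpa using h2, ?_⟩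
  rw [map_neg, inv_neg]
  exact neg_mem h3

lemma Lead.sub_high {n : ℕ} (h : Λ.Lead n f) (hp : p ∈ IntS Λ.B) (hg : HX N g p) (h0 : ∀ m ≤ n, coeff m p = 0) :
    Λ.Lead n (f - g) := by
  obtain ⟨q, hq, hq', h1, h2, h3⟩ := h
  refine ⟨q - p, sub_mem hq hp, hq'.sub hg, fun m hm => ?_, ?_, ?_⟩
  · rw [map_sub, h1 m hm, h0 m hm.le, sub_zero]
  · rwa [map_sub, h0 n le_rfl, sub_zero]
  · rwa [map_sub, h0 n le_rfl, sub_zero]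

lemma psi_Lead (hN : 3 ≤ N) : Λ.Lead 1 (psi N) := by
  obtain ⟨p, hp, hp', h0, h1⟩ := psi_low hN Λ 1 (by
    simp
    intro h
    have := Int.eq_one_of_dvd_one (by omega) h
    omega)
  rw [sl_one] at hp'
  have h2 : AE N ![((1 : SL(2, ℤ)) 0 0), ((1 : SL(2, ℤ)) 0 1)] (1, 1) = 1 := by
    simp only [AE]
    rw [if_pos (by simp), if_neg]
    · simp
    · simp
      intro h
      have := Int.le_of_dvd (by norm_num) h
      omega
  rw [h2] at h1
  exact ⟨p, hp, hp', fun m hm => by rwa [Nat.lt_one_iff.mp hm], by simp [h1], by simp [h1]⟩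

lemma lemC_z (hN : 1 ≤ N) (h : SL(2, ℤ)) (hz : ¬ (N : ℤ) ∣ h 1 0) :
    ∃ φ, Lk N Λ.B 12 φ ∧ ∃ n, Λ.Lead n (sl 12 φ h - φ) := by
  obtain ⟨p, hp, hp', h0, -⟩ := uM_lead Λ hN hN dvd_rfl 1
  rw [sl_one] at hp'
  refine ⟨uM N hN, uM_Lk Λ hN hN dvd_rfl, _, (uM_lead Λ hN hN dvd_rfl h).sub_high hp hp' ?_⟩
  · intro m hm
    refine h0 m (lt_of_le_of_lt hm ?_)
    have h1 : Int.gcd N (h 1 0) < N := by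
      refine lt_of_le_of_ne (Nat.le_of_dvd hN ?_) fun e => hz ?_
      · have := Int.gcd_dvd_left (a := (N : ℤ)) (b := h 1 0)
        exact_mod_cast this
      · have := Int.gcd_dvd_right (a := (N : ℤ)) (b := h 1 0)
        rwa [e] at this
    have h2 : Int.gcd N ((1 : SL(2, ℤ)) 1 0) = N := by simp
    rw [h2, Nat.div_self hN, mul_one, mul_one]
    gcongr

lemma lemC_x (hN : 3 ≤ N) (h : SL(2, ℤ)) (hx : ¬ (N : ℤ) ∣ h 0 0) (h1 : ¬ (N : ℤ) ∣ 1 - h 0 0)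
    (h2 : ¬ (N : ℤ) ∣ -1 - h 0 0) :
    ∃ φ, Lk N Λ.B 12 φ ∧ ∃ n, Λ.Lead n (sl 12 φ h - φ) := by
  obtain ⟨p, hp, hp', h3, h4⟩ := psi_low hN Λ h hx
  have h5 : AE N ![h 0 0, h 0 1] (1, 1) = 0 := by
    simp only [AE]
    rw [if_neg, if_neg]
    · simp
    · simpa using h2
    · simpa using h1
  rw [h5] at h4
  have h6 : PowerSeries.X ^ 2 ∣ p := PowerSeries.X_pow_dvd_iff.mpr fun m hm => by interval_cases m <;> assumption
  have h7 : PowerSeries.X ^ 8 ∣ p ^ 4 := by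
    have := pow_dvd_pow_of_dvd h6 4
    rwa [← pow_mul] at this
  refine ⟨psi N ^ 4, (psi_Lk hN Λ).pow 4, 1 * 4, ?_⟩
  have e : sl 12 (psi N ^ 4) h = sl 3 (psi N) h ^ 4 := sl_pow 3 4 _ _
  have := ((psi_Lead (Λ := Λ) hN).pow 4).sub_high (pow_mem hp 4) (hp'.pow 4) fun m hm =>
    PowerSeries.X_pow_dvd_iff.mp h7 m (by omega)
  rw [e, ← neg_sub]
  exact this.neg

lemma lemC_T (hN : 1 ≤ N) (h : SL(2, ℤ)) (hz : (N : ℤ) ∣ h 1 0) (h1 : (N : ℤ) ∣ 1 - h 0 0)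
    (h2 : h ∉ CongruenceSubgroup.Gamma N) :
    ∃ φ, Lk N Λ.B 12 φ ∧ ∃ n, Λ.Lead n (sl 12 φ h - φ) := by
  have hdet := h.det_coe
  rw [Matrix.det_fin_two] at hdet
  have h3 : (N : ℤ) ∣ 1 - h 1 1 := by
    have : 1 - h 1 1 = h 0 0 * h 1 1 - h 0 1 * h 1 0 - h 1 1 := by rw [hdet]
    have e : 1 - h 1 1 = -((1 - h 0 0) * h 1 1) - h 0 1 * h 1 0 := by rw [this]; ring
    rw [e]
    exact dvd_sub (dvd_neg.mpr (h1.mul_right _)) (hz.mul_left _)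
  have hNZ : (0 : ℤ) < N := by exact_mod_cast hN
  obtain ⟨n, hn⟩ : ∃ n : ℕ, (n : ℤ) = h 0 1 % N := ⟨(h 0 1 % N).toNat, Int.toNat_of_nonneg (Int.emod_nonneg _ hNZ.ne')⟩
  have hn' : (N : ℤ) ∣ n - h 0 1 := by
    rw [hn]
    exact (Int.mod_modEq _ _).symm.dvd
  have hT : ∀ i j, (N : ℤ) ∣ (ModularGroup.T ^ n) i j - h i j := by
    have e : ((ModularGroup.T ^ n : SL(2, ℤ)) : Matrix (Fin 2) (Fin 2) ℤ) = !![1, (n : ℤ); 0, 1] := by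
      have := ModularGroup.coe_T_zpow n
      rwa [zpow_natCast] at this
    intro i j
    rw [e]
    fin_cases i <;> fin_cases j <;> simp <;> assumption
  have hγ := gamma_of_congr hT
  have hnN : ¬ N ∣ n := by
    rintro ⟨c, hc⟩
    refine h2 ?_
    rw [CongruenceSubgroup.Gamma_mem]
    refine ⟨?_, ?_, ?_, ?_⟩
    · have := (ZMod.intCast_zmod_eq_zero_iff_dvd _ _).mpr h1
      push_cast at this
      exact (sub_eq_zero.mp this).symm
    · rw [ZMod.intCast_zmod_eq_zero_iff_dvd]
      have : h 0 1 = n - (n - h 0 1) := by ring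
      rw [this]
      exact dvd_sub ⟨c, by exact_mod_cast hc⟩ hn'
    · exact (ZMod.intCast_zmod_eq_zero_iff_dvd _ _).mpr hz
    · have := (ZMod.intCast_zmod_eq_zero_iff_dvd _ _).mpr h3
      push_cast at this
      exact (sub_eq_zero.mp this).symm
  have hL := (uM_Lk Λ hN hN dvd_rfl).slash ModularGroup.S
  set φ := sl 12 (uM N hN) ModularGroup.S with hφ
  have hl : Λ.Lead 1 φ := by
    have := uM_lead Λ hN hN dvd_rfl ModularGroup.S
    have e : Int.gcd N (ModularGroup.S 1 0) = 1 := by simp [ModularGroup.S]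
    rwa [e, Nat.div_self hN] at this
  refine ⟨φ, hL, 1, ?_⟩
  have e : sl 12 φ h = sl 12 φ (ModularGroup.T ^ n) := by
    have e1 : h = (ModularGroup.T ^ n * ((ModularGroup.T ^ n)⁻¹ * h) * (ModularGroup.T ^ n)⁻¹) * ModularGroup.T ^ n := by group
    rw [e1, ← sl_comp, hL.1 _ ((Gamma_normal N).conj_mem _ hγ _)]
  rw [e]
  obtain ⟨p, hp, hp', h4, h5, h6⟩ := hl
  obtain ⟨hz1, hz2⟩ := Λ.zeta_sub hN hnN
  have hc : coeff 1 (PowerSeries.rescale (zetaC N ^ n) p - p) = (zetaC N ^ n - 1) * coeff 1 p := by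
    rw [map_sub, PowerSeries.coeff_rescale]; ring
  refine ⟨_, sub_mem ?_ hp, (sl_T_pow hp' n).sub hp', ?_, ?_, ?_⟩
  · intro m
    rw [PowerSeries.coeff_rescale]
    exact mul_mem (pow_mem (pow_mem Λ.zeta _) _) (hp m)
  · intro m hm
    rw [map_sub, PowerSeries.coeff_rescale, h4 m hm]; ring
  · rw [hc]; exact mul_ne_zero hz1 h5
  · rw [hc, mul_inv]; exact mul_mem hz2 h6

lemma lemC (hN : 1 ≤ N) (h : SL(2, ℤ)) (h1 : h ∉ CongruenceSubgroup.Gamma N)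
    (h2 : -h ∉ CongruenceSubgroup.Gamma N) :
    ∃ φ, Lk N Λ.B 12 φ ∧ ∃ n, Λ.Lead n (sl 12 φ h - φ) := by
  by_cases hz : (N : ℤ) ∣ h 1 0
  swap
  · exact lemC_z hN h hz
  by_cases hx : (N : ℤ) ∣ 1 - h 0 0
  · exact lemC_T hN h hz hx h1
  by_cases hx2 : (N : ℤ) ∣ -1 - h 0 0
  · obtain ⟨φ, hφ, n, hn⟩ := lemC_T (Λ := Λ) hN (-h) (by simpa using hz)
      (by rw [← dvd_neg]; simp; convert! hx2 using 1; ring) h2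
    refine ⟨φ, hφ, n, ?_⟩
    have e : -h = (-1) * h := by simp
    rwa [e, ← sl_comp, sl_neg_one (by decide)] at hn
  have hdet := h.det_coe
  rw [Matrix.det_fin_two] at hdet
  have hx0 : ¬ (N : ℤ) ∣ h 0 0 := by
    intro hd
    have : (N : ℤ) ∣ 1 := by
      rw [← hdet]
      exact dvd_sub (hd.mul_right _) (hz.mul_left _)
    exact hx (this.trans (one_dvd _))
  refine lemC_x ?_ h hx0 hx hx2
  by_contra hlt
  have : N = 1 ∨ N = 2 := by omega
  rcases this with rfl | rfl <;> omega

end Loc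
end QP

namespace QP
open PowerSeries (coeff)
open scoped Manifold

/-- plus-minus Gamma(N) -/
def PG (N : ℕ) : Subgroup SL(2, ℤ) where
  carrier := {h | h ∈ CongruenceSubgroup.Gamma N ∨ -h ∈ CongruenceSubgroup.Gamma N}
  one_mem' := Or.inl (one_mem _)
  mul_mem' := by
    rintro a b (ha | ha) (hb | hb)
    · exact Or.inl (mul_mem ha hb)
    · right; rw [← mul_neg]; exact mul_mem ha hb
    · right; rw [← neg_mul]; exact mul_mem ha hb
    · left; rw [← neg_mul_neg]; exact mul_mem ha hb
  inv_mem' := by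
    rintro a (ha | ha)
    · exact Or.inl (inv_mem ha)
    · right
      have : -a⁻¹ = (-a)⁻¹ := by
        rw [eq_inv_iff_mul_eq_one]; simp
      rw [this]; exact inv_mem ha

lemma mem_PG {N : ℕ} {h : SL(2, ℤ)} : h ∈ PG N ↔ h ∈ CongruenceSubgroup.Gamma N ∨ -h ∈ CongruenceSubgroup.Gamma N := Iff.rfl

lemma PG_conj {N : ℕ} {h : SL(2, ℤ)} (hh : h ∈ PG N) (g : SL(2, ℤ)) : g * h * g⁻¹ ∈ PG N := by
  rcases hh with hh | hh
  · exact Or.inl ((Gamma_normal N).conj_mem _ hh g)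
  · right
    have := (Gamma_normal N).conj_mem _ hh g
    simpa using this

lemma GInv.PG {N k : ℕ} (hk : Even k) {f : ℍ → ℂ} (hf : GInv N k f) {h : SL(2, ℤ)} (hh : h ∈ PG N) : sl k f h = f := by
  rcases hh with hh | hh
  · exact hf h hh
  · have : h = (-1) * (-h) := by simp
    rw [this, ← sl_comp, sl_neg_one hk, hf _ hh]

namespace Loc
variable {N : ℕ} {Λ : Loc N} {k l : ℕ} {f g : ℍ → ℂ} {p : PowerSeries ℂ}

lemma decomposition (hN : 1 ≤ N) (t : ℕ) {F : ℍ → ℂ} (hF : GInv N (12 * t) F)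
    (hFx : ∀ g, ∃ p, HX N (sl (12 * t) F g) p) (g : SL(2, ℤ)) :
    ∃ n δ, Lk N Λ.B (12 * n) δ ∧ (∃ m, Λ.Lead m (sl (12 * n) δ g)) ∧
      F * δ ∈ Submodule.span ℂ {v | Lk N Λ.B (12 * (t + n)) v} := by
  classical
  have hfi := Gamma_fi hN
  have : (PG N).FiniteIndex := Subgroup.finiteIndex_of_le (fun x hx => Or.inl hx : CongruenceSubgroup.Gamma N ≤ PG N)
  have : Fintype (SL(2, ℤ) ⧸ PG N) := Fintype.ofFinite _
  set J := Finset.univ.erase ((1 : SL(2, ℤ)) : SL(2, ℤ) ⧸ PG N) with hJ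
  have hC : ∀ q ∈ J, ∃ φ, Lk N Λ.B 12 φ ∧ ∃ n, Λ.Lead n (sl 12 (sl 12 φ q.out⁻¹ - φ) g) := by
    intro q hq
    have h1 : q.out⁻¹ ∉ PG N := fun h => (Finset.mem_erase.mp hq).1 ((out_mem _ _).mp h)
    have h2 : g⁻¹ * q.out⁻¹ * g ∉ PG N := fun h => h1 (by
      have := PG_conj h g
      convert this using 1
      group)
    rw [mem_PG, not_or] at h2
    obtain ⟨φ, hφ, n, hn⟩ := lemC (Λ := Λ) hN _ h2.1 h2.2
    refine ⟨sl 12 φ g⁻¹, hφ.slash _, n, ?_⟩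
    have e : sl 12 (sl 12 (sl 12 φ g⁻¹) q.out⁻¹) g = sl 12 φ (g⁻¹ * q.out⁻¹ * g) := by
      simp only [sl_comp, mul_assoc]
    rw [sl_sub, e, sl_comp, inv_mul_cancel, sl_one]
    exact hn
  choose! φ hφ hlead using hC
  set y : SL(2, ℤ) ⧸ PG N → ℍ → ℂ := fun q => sl 12 (φ q) q.out⁻¹ with hy
  have hyL : ∀ q ∈ J, Lk N Λ.B 12 (y q) := fun q hq => (hφ q hq).slash _
  set δ := ∏ q ∈ J, (y q + -φ q) with hδ
  have hz : ∀ T ⊆ J, Lk N Λ.B (12 * T.card) (∏ q ∈ T, -φ q) := fun T hT => Lk.prod T fun q hq => (hφ q (hT hq)).neg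
  refine ⟨J.card, δ, Lk.prod J fun q hq => ?_, ?_, ?_⟩
  · rw [← sub_eq_add_neg]; exact (hyL q hq).sub (hφ q hq)
  · rw [hδ, sl_prod]
    refine Lead.prod J fun q hq => ?_
    rw [← sub_eq_add_neg]
    exact hlead q hq
  -- the trace identity
  have hTr : F * δ = ∑ S ∈ J.powerset, (∏ q ∈ S, y q) * ∑ r : SL(2, ℤ) ⧸ PG N,
      sl (12 * t + 12 * (J \ S).card) (F * ∏ q ∈ J \ S, -φ q) r.out⁻¹ := by
    simp only [Finset.mul_sum]
    rw [Finset.sum_comm]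
    have h1 : ∀ r : SL(2, ℤ) ⧸ PG N, ∑ S ∈ J.powerset, (∏ q ∈ S, y q) * 
        sl (12 * t + 12 * (J \ S).card) (F * ∏ q ∈ J \ S, -φ q) r.out⁻¹ = 
        sl (12 * t) F r.out⁻¹ * ∏ q ∈ J, (y q + sl 12 (-φ q) r.out⁻¹) := by
      intro r
      rw [Finset.prod_add, Finset.mul_sum]
      refine Finset.sum_congr rfl fun S _ => ?_
      rw [sl_mul, sl_prod]
      ring
    simp only [h1]
    rw [← Finset.sum_erase_add Finset.univ _ (Finset.mem_univ ((1 : SL(2, ℤ)) : SL(2, ℤ) ⧸ PG N))]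
    rw [Finset.sum_eq_zero, zero_add]
    · have h2 := (out_mem (PG N) ((1 : SL(2, ℤ)) : SL(2, ℤ) ⧸ PG N)).mpr rfl
      rw [hF.PG ((by decide : Even 12).mul_right _) h2, hδ]
      congr 1
      refine Finset.prod_congr rfl fun q hq => ?_
      rw [sl_neg, (hφ q hq).1.PG (by decide) h2]
    · intro r hr
      rw [Finset.prod_eq_zero hr, mul_zero]
      rw [sl_neg]
      exact add_neg_cancel _
  rw [hTr]
  refine Submodule.sum_mem _ fun S hS => ?_
  rw [Finset.mem_powerset] at hS
  set T := J \ S with hT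
  have hTJ : T ⊆ J := Finset.sdiff_subset
  have hcard : T.card + S.card = J.card := Finset.card_sdiff_add_card_eq_card hS
  set G := F * ∏ q ∈ T, -φ q
  have hG : GInv N (12 * t + 12 * T.card) G := hF.mul (hz T hTJ).1
  have hGx : ∀ g, ∃ p, HX N (sl (12 * t + 12 * T.card) G g) p := fun g => by
    obtain ⟨p, hp⟩ := hFx g
    obtain ⟨r, -, hr⟩ := (hz T hTJ).2 g
    exact ⟨p * r, by rw [sl_mul]; exact hp.mul hr⟩
  set Tr := ∑ r : SL(2, ℤ) ⧸ PG N, sl (12 * t + 12 * T.card) G r.out⁻¹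
  have hInv : Inv1 (12 * (t + T.card : ℕ)) Tr := fun g => by
    have h1 : sl (12 * t + 12 * T.card) Tr g = ∑ q : SL(2, ℤ) ⧸ PG N, sl (12 * t + 12 * T.card) G (q.out⁻¹ * g) := by
      rw [sl_sum]; exact Finset.sum_congr rfl fun i _ => sl_comp ..
    rw [coset_sum (PG N) (fun x => sl (12 * t + 12 * T.card) G x) (fun h hh x => by
      rw [← sl_comp, hG.PG (by rw [← mul_add]; exact (by decide : Even 12).mul_right _) hh]) g] at h1
    rw [sl] at h1
    convert! h1 using 2
    push_cast; ring
  choose P hP using hGx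
  obtain ⟨hc1, -⟩ := HX.contract hN hInv (HX.sum Finset.univ fun r _ => hP r.out⁻¹)
  obtain ⟨a, ha, -⟩ := lvl1_struct _ _ _ hInv hc1
  rw [ha, Finset.mul_sum]
  refine Submodule.sum_mem _ fun j hj => ?_
  rw [mul_smul_comm]
  refine Submodule.smul_mem _ _ (Submodule.subset_span ?_)
  have hj' : j ≤ t + T.card := by have := Finset.mem_range.mp hj; omega
  have h1 : Lk N Λ.B (12 * S.card) (∏ q ∈ S, y q) := Lk.prod S fun q hq => hyL q (hS hq)
  have h2 : Lk N Λ.B (12 * (t + T.card)) (Dl ^ j * E4 ^ (3 * (t + T.card - j))) :=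
    Lk_lvl1 hN (by have := lv_inv _ j hj'; exact_mod_cast this) (lv_HX _ _)
  have h3 := h1.mul h2
  have e : 12 * S.card + 12 * (t + T.card) = 12 * (t + J.card) := by rw [← hcard]; ring
  rwa [e] at h3

end Loc
end QP

namespace QP
open PowerSeries (coeff)
open scoped Manifold

namespace Loc
variable {N : ℕ} {Λ : Loc N} {k l : ℕ} {f g : ℍ → ℂ} {p : PowerSeries ℂ}

lemma HX_zero_fun (h : HX N f 0) : f = 0 := by
  funext τ
  have := h τ
  simp only [map_zero, zero_mul] at this
  exact this.unique hasSum_zero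

lemma normalize (hN : 1 ≤ N) {v : ℍ → ℂ} (hv : Lk N Λ.B k v) (h0 : v ≠ 0) :
    ∃ (c : ℂ) (u : ℍ → ℂ) (p : PowerSeries ℂ) (n : ℕ), v = c • u ∧ Lk N Λ.B k u ∧ HX N u p ∧ p ∈ IntS Λ.B ∧
      coeff n p ≠ 0 ∧ (coeff n p)⁻¹ ∈ Λ.B := by
  classical
  obtain ⟨p, hp, hp'⟩ := hv.exp
  have hex : ∃ m n : ℕ, ∃ u, u ∈ Λ.B ∧ u⁻¹ ∈ Λ.B ∧ u ≠ 0 ∧ coeff n p = Λ.w ^ m * u := by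
    have : ∃ n, coeff n p ≠ 0 := by
      by_contra! hc
      have : p = 0 := by ext n; simp [hc n]
      rw [this] at hp'
      exact h0 (HX_zero_fun hp')
    obtain ⟨n, hn⟩ := this
    obtain ⟨m, u, h⟩ := Λ.decomp (hp n) hn
    exact ⟨m, n, u, h⟩
  set m := Nat.find hex with hm
  obtain ⟨n, u, hu, hu', hu0, e⟩ := Nat.find_spec hex
  rw [← hm] at e
  have hw := Λ.w_ne
  have hwm : Λ.w ^ m ≠ 0 := pow_ne_zero _ hw
  have hdiv : (Λ.w ^ m)⁻¹ • p ∈ IntS Λ.B := fun j => by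
    rw [map_smul, smul_eq_mul]
    by_cases hj : coeff j p = 0
    · simp [hj]
    · obtain ⟨m', u', h1, h2, h3, h4⟩ := Λ.decomp (hp j) hj
      have : m ≤ m' := Nat.find_min' hex ⟨j, u', h1, h2, h3, h4⟩
      obtain ⟨d, rfl⟩ := Nat.exists_eq_add_of_le this
      rw [h4, pow_add]
      have : (Λ.w ^ m)⁻¹ * (Λ.w ^ m * Λ.w ^ d * u') = Λ.w ^ d * u' := by field_simp
      rw [this]
      exact mul_mem (pow_mem Λ.w_mem _) h1
  have hX : HX N ((Λ.w ^ m)⁻¹ • v) ((Λ.w ^ m)⁻¹ • p) := hp'.smul _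
  have e2 : coeff n ((Λ.w ^ m)⁻¹ • p) = u := by
    rw [map_smul, smul_eq_mul, e]; field_simp
  have e3 : Λ.w ^ m • ((Λ.w ^ m)⁻¹ • v) = v := by rw [smul_smul, mul_inv_cancel₀ hwm, one_smul]
  refine ⟨Λ.w ^ m, (Λ.w ^ m)⁻¹ • v, _, n, e3.symm, ?_, hX, hdiv, ?_, ?_⟩
  · refine claimP' hN m ?_ ⟨_, hdiv, hX⟩
    rwa [e3]
  · rwa [e2]
  · rwa [e2]

lemma echelon (hN : 1 ≤ N) {ι : Type} (s : Finset ι) (S : AddSubgroup ℂ) (hS : ∀ b ∈ Λ.B, ∀ x ∈ S, x * b ∈ S) (g : SL(2, ℤ)) :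
    ∀ (v : ι → ℍ → ℂ) (a : ι → ℂ), (∀ i ∈ s, Lk N Λ.B k (v i)) → ∀ p, HX N (∑ i ∈ s, a i • v i) p →
      (∀ n, coeff n p ∈ S) → ∃ r, HX N (sl k (∑ i ∈ s, a i • v i) g) r ∧ ∀ n, coeff n r ∈ S := by
  classical
  induction s using Finset.induction_on with
  | empty =>
    intro v a _ p _ _
    refine ⟨0, ?_, by simp⟩
    have : sl k (0 : ℍ → ℂ) g = 0 := by have := sl_smul k 0 (0 : ℍ → ℂ) g; rwa [zero_smul, zero_smul] at this
    rw [Finset.sum_empty, this]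
    exact HX.zero
  | insert i s hi ih =>
    intro v a hv p hp hpS
    rw [Finset.sum_insert hi] at hp ⊢
    by_cases h0 : v i = 0
    · rw [h0, smul_zero, zero_add] at hp ⊢
      exact ih v a (fun j hj => hv j (by simp [hj])) p hp hpS
    obtain ⟨c, u, P, n, hvu, huL, hP, hPI, hn0, hninv⟩ := normalize hN (hv i (by simp)) h0
    have hex : ∀ j ∈ s, ∃ q ∈ IntS Λ.B, HX N (v j) q := fun j hj => (hv j (by simp [hj])).exp
    choose! q hq hq' using hex
    set b : ι → ℂ := fun j => coeff n (q j) * (coeff n P)⁻¹ with hb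
    set v' : ι → ℍ → ℂ := fun j => v j - b j • u with hv'
    have hbB : ∀ j ∈ s, b j ∈ Λ.B := fun j hj => mul_mem (hq j hj n) hninv
    set C : ℂ := coeff n p * (coeff n P)⁻¹ with hC
    have hCS : C ∈ S := hS _ hninv _ (hpS n)
    set C' : ℂ := a i * c + ∑ j ∈ s, a j * b j with hC'
    have e1 : a i • v i + ∑ j ∈ s, a j • v j = C' • u + ∑ j ∈ s, a j • v' j := by
      simp only [hv', hC', hvu, smul_sub, Finset.sum_sub_distrib, add_smul, Finset.sum_smul, smul_smul]
      abel
    have hv'X : ∀ j ∈ s, HX N (v' j) (q j - b j • P) := fun j hj => (hq' j hj).sub (hP.smul _)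
    have e2 : ∀ j ∈ s, coeff n (q j - b j • P) = 0 := fun j hj => by
      rw [map_sub, map_smul, smul_eq_mul, hb]
      field_simp
      ring
    have hsumX := HX.sum s fun j hj => (hv'X j hj).smul (a j)
    have hCC : C' = C := by
      have h1 := hp.unique hN (by rw [e1]; exact (hP.smul C').add hsumX)
      have h2 := congrArg (coeff n) h1
      rw [map_add, map_sum, Finset.sum_eq_zero, add_zero, map_smul, smul_eq_mul] at h2
      · rw [hC, h2]; field_simp
      · intro j hj
        rw [map_smul, e2 j hj, smul_zero]
    rw [hCC] at e1
    rw [e1] at hp ⊢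
    have h3 : HX N (∑ j ∈ s, a j • v' j) (p - C • P) := by
      have := hp.sub (hP.smul C)
      rwa [add_sub_cancel_left] at this
    obtain ⟨r, hr, hrS⟩ := ih v' a (fun j hj => (hv j (by simp [hj])).sub (huL.smul (hbB j hj))) _ h3 (fun m => by
      rw [map_sub, map_smul, smul_eq_mul]
      exact sub_mem (hpS m) (hS _ (hPI m) _ hCS))
    obtain ⟨R, hR, hR'⟩ := huL.2 g
    refine ⟨C • R + r, ?_, fun m => ?_⟩
    · rw [sl_add, sl_smul]
      exact (hR'.smul C).add hr
    · rw [map_add, map_smul, smul_eq_mul]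
      exact add_mem (hS _ (hR m) _ hCS) (hrS m)

lemma echelon_span (hN : 1 ≤ N) (S : AddSubgroup ℂ) (hS : ∀ b ∈ Λ.B, ∀ x ∈ S, x * b ∈ S) (g : SL(2, ℤ))
    {f : ℍ → ℂ} (hf : f ∈ Submodule.span ℂ {v | Lk N Λ.B k v}) {p} (hp : HX N f p)
    (h : ∀ n, coeff n p ∈ S) : ∃ r, HX N (sl k f g) r ∧ ∀ n, coeff n r ∈ S := by
  obtain ⟨n, a, v, rfl⟩ := Submodule.mem_span_set'.mp hf
  exact echelon hN Finset.univ S hS g (fun i => (v i : ℍ → ℂ)) a (fun i _ => (v i).2) p hp h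

/-- dividing by a series with unit leading term -/
lemma divide (S : AddSubgroup ℂ) (hS : ∀ b ∈ Λ.B, ∀ x ∈ S, x * b ∈ S) {m : ℕ} {f d : ℍ → ℂ} (hN : 1 ≤ N)
    {p r : PowerSeries ℂ} (hp : HX N f p) (hd : Λ.Lead m d) (hr : HX N (f * d) r) (hrS : ∀ n, coeff n r ∈ S) (n : ℕ) :
    coeff n p ∈ S := by
  obtain ⟨s, hs, hs', h0, h1⟩ := lead_iff.mp hd
  have e := hr.unique hN (hp.mul hs')
  have h2 : ∀ n, coeff n (p * s) ∈ S := fun n => by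
    have : coeff n (p * s) = coeff (n + m) r := by
      rw [e, mul_left_comm, PowerSeries.coeff_X_pow_mul]
    rw [this]; exact hrS _
  induction n using Nat.strong_induction_on with
  | _ n ih =>
    have h3 := h2 n
    rw [PowerSeries.coeff_mul, Finset.Nat.sum_antidiagonal_eq_sum_range_succ_mk, Finset.sum_range_succ] at h3
    simp only [Nat.sub_self] at h3
    have h4 : ∑ j ∈ Finset.range n, coeff j p * coeff (n - j) s ∈ S :=
      sum_mem fun j hj => hS _ (hs _) _ (ih j (Finset.mem_range.mp hj))
    have h5 : coeff n p * coeff 0 s ∈ S := by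
      have := sub_mem h3 h4
      rwa [add_sub_cancel_left] at this
    have := hS _ h1 _ h5
    rwa [mul_assoc, mul_inv_cancel₀ h0, mul_one] at this

/-- weight divisible by twelve -/
lemma main12 (hN : 1 ≤ N) (t : ℕ) {F : ℍ → ℂ} (hF : GInv N (12 * t) F)
    (hFx : ∀ g, ∃ p, HX N (sl (12 * t) F g) p) (S : AddSubgroup ℂ) (hS : ∀ b ∈ Λ.B, ∀ x ∈ S, x * b ∈ S)
    {p} (hp : HX N F p) (h : ∀ n, coeff n p ∈ S) (g : SL(2, ℤ)) {q} (hq : HX N (sl (12 * t) F g) q) (n : ℕ) :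
    coeff n q ∈ S := by
  obtain ⟨l, δ, hδ, ⟨m, hm⟩, hsp⟩ := decomposition (Λ := Λ) hN t hF hFx g
  obtain ⟨P, hP, hP'⟩ := hδ.exp
  obtain ⟨r, hr, hrS⟩ := echelon_span hN S hS g hsp (hp.mul hP') (fun n => by
    rw [PowerSeries.coeff_mul]
    exact sum_mem fun x _ => hS _ (hP _) _ (h _))
  rw [mul_add, sl_mul] at hr
  exact divide S hS hN hq hm hr hrS n

end Loc
end QP

namespace QP
open PowerSeries (coeff)
open scoped Manifold

namespace Loc
variable {N : ℕ} {Λ : Loc N} {k l : ℕ} {f g : ℍ → ℂ} {p : PowerSeries ℂ}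

lemma lead_lvl1 (hN : 1 ≤ N) {P : PowerSeries ℤ} (hf : HX 1 f (toC P)) (h0 : coeff 0 P = 1) : Λ.Lead 0 f := by
  refine ⟨_, fun n => ?_, hf.expand hN, by simp, ?_, ?_⟩
  · rw [PowerSeries.coeff_mk]
    split_ifs
    · exact toC_IntS _ _ _
    · exact zero_mem _
  · simp [PowerSeries.coeff_mk, toC, h0, -PowerSeries.coeff_zero_eq_constantCoeff]
  · simp [PowerSeries.coeff_mk, toC, h0, -PowerSeries.coeff_zero_eq_constantCoeff]

lemma main_even (hN : 1 ≤ N) (j : ℕ) {F : ℍ → ℂ} (hF : GInv N (2 * j) F)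
    (hFx : ∀ g, ∃ p, HX N (sl (2 * j) F g) p) (S : AddSubgroup ℂ) (hS : ∀ b ∈ Λ.B, ∀ x ∈ S, x * b ∈ S)
    {p} (hp : HX N F p) (h : ∀ n, coeff n p ∈ S) (g : SL(2, ℤ)) {q} (hq : HX N (sl (2 * j) F g) q) (n : ℕ) :
    coeff n q ∈ S := by
  have h4 : Lk N Λ.B 4 E4 := Lk_lvl1 hN E4_inv E4_HX1
  have h6 : Lk N Λ.B 6 E6 := Lk_lvl1 hN E6_inv E6_HX1
  have l4 : Λ.Lead 0 E4 := lead_lvl1 hN E4_HX1 E4Z_zero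
  have l6 : Λ.Lead 0 E6 := lead_lvl1 hN E6_HX1 E6Z_zero
  have hL := (h4.mul h6).pow j
  have hl := (l4.mul l6).pow j
  set U := (E4 * E6) ^ j with hU
  have hUg : ∀ g, sl ((4 + 6) * j) U g = U := fun g => by
    rw [hU, sl_pow, sl_mul]
    congr 2
    · exact E4_inv g
    · exact E6_inv g
  have e : 2 * j + (4 + 6) * j = 12 * j := by ring
  have hGI := hF.mul hL.1
  rw [e] at hGI
  have hsl : ∀ g, sl (12 * j) (F * U) g = sl (2 * j) F g * U := fun g => by
    rw [← e, sl_mul, hUg]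
  obtain ⟨P, hP, hP'⟩ := hL.exp
  have hq' : HX N (sl (12 * j) (F * U) g) (q * P) := by rw [hsl]; exact hq.mul hP'
  have := main12 (Λ := Λ) hN j hGI (fun g => by
    obtain ⟨r, hr⟩ := hFx g
    exact ⟨_, by rw [hsl]; exact hr.mul hP'⟩) S hS (hp.mul hP') (fun n => by
      rw [PowerSeries.coeff_mul]
      exact sum_mem fun x _ => hS _ (hP _) _ (h _)) g hq'
  exact divide S hS hN hq hl (hq.mul hP') this n

lemma odd_small (hN1 : 1 ≤ N) (hN : N ≤ 2) (hk : Odd k) (hF : GInv N k f) : f = 0 := by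
  have h1 : (-1 : SL(2, ℤ)) ∈ CongruenceSubgroup.Gamma N := by
    have : N = 1 ∨ N = 2 := by omega
    rcases this with rfl | rfl
    · rw [CongruenceSubgroup.Gamma_mem]; simp; decide
    · rw [CongruenceSubgroup.Gamma_mem]; simp
  have h2 := hF _ h1
  funext τ
  have h3 := congrFun h2 τ
  rw [sl_apply] at h3
  simp [hk.neg_one_pow] at h3
  exact self_eq_neg.mp h3.symm

lemma main_all (hN : 1 ≤ N) (k : ℕ) {F : ℍ → ℂ} (hF : GInv N k F)
    (hFx : ∀ g, ∃ p, HX N (sl k F g) p) (S : AddSubgroup ℂ) (hS : ∀ b ∈ Λ.B, ∀ x ∈ S, x * b ∈ S)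
    {p} (hp : HX N F p) (h : ∀ n, coeff n p ∈ S) (g : SL(2, ℤ)) {q} (hq : HX N (sl k F g) q) (n : ℕ) :
    coeff n q ∈ S := by
  rcases Nat.even_or_odd' k with ⟨j, rfl | rfl⟩
  · exact main_even hN j hF hFx S hS hp h g hq n
  by_cases hN3 : 3 ≤ N
  swap
  · have := odd_small hN (by omega) ⟨j, rfl⟩ hF
    rw [this] at hq
    have h0 : sl (2 * j + 1) (0 : ℍ → ℂ) g = 0 := by
      have := sl_smul (2 * j + 1) 0 (0 : ℍ → ℂ) g; rwa [zero_smul, zero_smul] at this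
    rw [h0] at hq
    rw [hq.unique hN HX.zero]
    simp
  have hψ := (psi_Lk hN3 Λ).slash g⁻¹
  set U := sl 3 (psi N) g⁻¹ with hU
  have hl : Λ.Lead 1 (sl 3 U g) := by
    rw [hU, sl_comp, inv_mul_cancel, sl_one]; exact psi_Lead hN3
  have e : 2 * j + 1 + 3 = 2 * (j + 2) := by ring
  have hGI := hF.mul hψ.1
  rw [e] at hGI
  have hsl : ∀ g, sl (2 * (j + 2)) (F * U) g = sl (2 * j + 1) F g * sl 3 U g := fun g => by
    rw [← e, sl_mul]
  obtain ⟨P, hP, hP'⟩ := hψ.exp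
  obtain ⟨R, hR, hR'⟩ := hψ.2 g
  have hq' : HX N (sl (2 * (j + 2)) (F * U) g) (q * R) := by rw [hsl]; exact hq.mul hR'
  have := main_even (Λ := Λ) hN (j + 2) hGI (fun g => by
    obtain ⟨r, hr⟩ := hFx g
    obtain ⟨r', -, hr'⟩ := hψ.2 g
    exact ⟨_, by rw [hsl]; exact hr.mul hr'⟩) S hS (hp.mul hP') (fun n => by
      rw [PowerSeries.coeff_mul]
      exact sum_mem fun x _ => hS _ (hP _) _ (h _)) g hq'
  exact divide S hS hN hq hl (hq.mul hR') this n

end Loc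
end QP

namespace QP
open PowerSeries (coeff)
open scoped Manifold
open NumberField IsDedekindDomain

instance cycInst (N : ℕ) [NeZero N] : IsCyclotomicExtension {N} ℚ (CyclotomicField N ℚ) :=
  CyclotomicField.isCyclotomicExtension N ℚ

/-- cyclotomic setup -/
lemma cyc_emb {N : ℕ} [NeZero N] : ∃ (φ : CyclotomicField N ℚ →+* ℂ) (z : CyclotomicField N ℚ)
    (_ : IsPrimitiveRoot z N), φ z = zetaC N := by
  obtain ⟨φ⟩ : Nonempty (CyclotomicField N ℚ →+* ℂ) := inferInstance
  have h1 := IsCyclotomicExtension.zeta_spec N ℚ (CyclotomicField N ℚ)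
  have h2 := h1.map_of_injective φ.injective
  obtain ⟨i, -, hi⟩ := h2.eq_pow_of_pow_eq_one (ξ := zetaC N) (zeta_prim (NeZero.one_le)).pow_eq_one
  refine ⟨φ, IsCyclotomicExtension.zeta N ℚ (CyclotomicField N ℚ) ^ i, ?_, by simpa using hi⟩
  refine IsPrimitiveRoot.of_map_of_injective (f := φ) ?_ φ.injective
  rw [map_pow, hi]
  exact zeta_prim (NeZero.one_le)

lemma int_mem {N : ℕ} [NeZero N] {φ : CyclotomicField N ℚ →+* ℂ} {z : CyclotomicField N ℚ}
    (hz : IsPrimitiveRoot z N) (R : Subring ℂ) (hR : φ z ∈ R) (x : 𝓞 (CyclotomicField N ℚ)) :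
    φ (x : CyclotomicField N ℚ) ∈ R := by
  have h : x ∈ Algebra.adjoin ℤ {hz.toInteger} := by
    rw [IsCyclotomicExtension.Rat.adjoin_singleton_eq_top hz]; trivial
  induction h using Algebra.adjoin_induction with
  | mem x hx => rw [Set.mem_singleton_iff] at hx; subst hx; exact hR
  | algebraMap r => simp
  | add x y _ _ hx hy => simpa using add_mem hx hy
  | mul x y _ _ hx hy => simpa using mul_mem hx hy

def mkLoc {N : ℕ} [NeZero N] {φ : CyclotomicField N ℚ →+* ℂ} {z : CyclotomicField N ℚ}
    (hz : IsPrimitiveRoot z N) (hφ : φ z = zetaC N)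
    (v : HeightOneSpectrum (𝓞 (CyclotomicField N ℚ)))
    (hv : (N : 𝓞 (CyclotomicField N ℚ)) ∉ v.asIdeal) : Loc N where
  B := ((v.valuation (CyclotomicField N ℚ)).integer).map φ
  w := φ (v.valuation_exists_uniformizer (CyclotomicField N ℚ)).choose
  w_mem := ⟨_, by
    have := (v.valuation_exists_uniformizer (CyclotomicField N ℚ)).choose_spec
    show v.valuation _ _ ≤ 1
    rw [this, ← WithZero.exp_zero, WithZero.exp_le_exp]; norm_num, rfl⟩
  w_ne := by
    rw [Ne, map_eq_zero]
    exact v.valuation_uniformizer_ne_zero _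
  dich := by
    rintro _ ⟨x, hx, rfl⟩
    have hw := (v.valuation_exists_uniformizer (CyclotomicField N ℚ)).choose_spec
    have hw0 := v.valuation_uniformizer_ne_zero (CyclotomicField N ℚ)
    set w := (v.valuation_exists_uniformizer (CyclotomicField N ℚ)).choose
    have hx' : v.valuation (CyclotomicField N ℚ) x ≤ 1 := hx
    rcases hx'.lt_or_eq with h | h
    · left
      refine ⟨φ (w⁻¹ * x), ⟨_, ?_, rfl⟩, ?_⟩
      · show v.valuation _ _ ≤ 1
        rw [map_mul, map_inv₀, hw]
        by_cases h0 : x = 0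
        · simp [h0]
        have h1 : v.valuation (CyclotomicField N ℚ) x ≠ 0 := by simpa using h0
        rw [← WithZero.exp_log h1, ← WithZero.exp_zero] at h ⊢
        rw [WithZero.exp_lt_exp] at h
        rw [← WithZero.exp_neg, ← WithZero.exp_add, WithZero.exp_le_exp]
        lia
      · rw [← map_mul, mul_inv_cancel_left₀ hw0]
    · right
      exact ⟨x⁻¹, by show v.valuation _ _ ≤ 1; rw [map_inv₀, h, inv_one], map_inv₀ _ _⟩
  w_inv := by
    rintro ⟨y, hy, h⟩
    have hw := (v.valuation_exists_uniformizer (CyclotomicField N ℚ)).choose_spec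
    set w := (v.valuation_exists_uniformizer (CyclotomicField N ℚ)).choose
    rw [← map_inv₀] at h
    have h := φ.injective h
    subst h
    have hy : v.valuation (CyclotomicField N ℚ) w⁻¹ ≤ 1 := hy
    rw [map_inv₀, hw, ← WithZero.exp_neg, ← WithZero.exp_zero, WithZero.exp_le_exp] at hy
    norm_num at hy
  sep := by
    intro x hx
    have hw := (v.valuation_exists_uniformizer (CyclotomicField N ℚ)).choose_spec
    set w := (v.valuation_exists_uniformizer (CyclotomicField N ℚ)).choose
    obtain ⟨_, ⟨y, hy, rfl⟩, h⟩ := hx 0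
    rw [pow_zero, one_mul] at h
    subst h
    by_cases h0 : y = 0
    · simp [h0]
    have h1 : v.valuation (CyclotomicField N ℚ) y ≠ 0 := by simpa using h0
    exfalso
    obtain ⟨_, ⟨b, hb, rfl⟩, h⟩ := hx ((- WithZero.log (v.valuation (CyclotomicField N ℚ) y)).toNat + 1)
    have hb : v.valuation (CyclotomicField N ℚ) b ≤ 1 := hb
    erw [← map_pow, ← map_mul] at h
    have h := φ.injective h
    have h2 := congrArg (v.valuation (CyclotomicField N ℚ)) h
    rw [map_mul, map_pow, hw] at h2
    have h3 : v.valuation (CyclotomicField N ℚ) y ≤ WithZero.exp (-1 : ℤ) ^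
      ((- WithZero.log (v.valuation (CyclotomicField N ℚ) y)).toNat + 1) := by
      conv_lhs => rw [h2]
      exact mul_le_of_le_one_right' hb
    nth_rewrite 1 [← WithZero.exp_log h1] at h3
    rw [← WithZero.exp_nsmul, WithZero.exp_le_exp, nsmul_eq_mul] at h3
    push_cast at h3
    lia
  zeta := ⟨z, v.valuation_le_one hz.toInteger, hφ⟩
  Ninv := ⟨(N : CyclotomicField N ℚ)⁻¹, by
    show v.valuation _ _ ≤ 1
    have := (v.valuation_eq_one_iff_notMem (K := CyclotomicField N ℚ)).2 hv
    rw [map_natCast] at this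
    rw [map_inv₀, this, inv_one], by simp⟩

lemma ideal_arg {N : ℕ} [NeZero N] (I : Ideal (𝓞 (CyclotomicField N ℚ)))
    (h : ∀ v : HeightOneSpectrum (𝓞 (CyclotomicField N ℚ)),
      (N : 𝓞 (CyclotomicField N ℚ)) ∉ v.asIdeal → ∃ s ∈ I, s ∉ v.asIdeal) :
    ∃ m : ℕ, (N : 𝓞 (CyclotomicField N ℚ)) ^ m ∈ I := by
  have hI : I ≠ ⊥ := by
    rintro rfl
    have hu : ¬ IsUnit ((N + 1 : ℕ) : 𝓞 (CyclotomicField N ℚ)) := by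
      intro hu
      have h1 : IsUnit (algebraMap ℤ (𝓞 (CyclotomicField N ℚ)) ((N + 1 : ℕ) : ℤ)) := by
        rw [map_natCast]; exact hu
      have := isUnit_of_map_unit (algebraMap ℤ (𝓞 (CyclotomicField N ℚ))) _ h1
      rw [Int.isUnit_iff] at this
      have := NeZero.ne N
      lia
    obtain ⟨M, hM, hM'⟩ := exists_max_ideal_of_mem_nonunits hu
    have hNM : (N : 𝓞 (CyclotomicField N ℚ)) ∉ M := by
      intro h
      apply hM.ne_top
      rw [Ideal.eq_top_iff_one]
      have := M.sub_mem hM' h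
      simpa using this
    obtain ⟨s, hs, hs'⟩ := h ⟨M, hM.isPrime, by
      rintro rfl
      rw [Ideal.mem_bot] at hM'
      exact Nat.cast_ne_zero.2 (Nat.succ_ne_zero N) hM'⟩ hNM
    rw [Ideal.mem_bot] at hs
    exact hs' (hs ▸ M.zero_mem)
  show (N : 𝓞 (CyclotomicField N ℚ)) ∈ I.radical
  rw [Ideal.radical_eq_sInf, Ideal.mem_sInf]
  rintro P ⟨hP, hP'⟩
  by_contra hN
  obtain ⟨s, hs, hs'⟩ := h ⟨P, hP', fun h0 => hI (le_bot_iff.1 (h0 ▸ hP))⟩ hN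
  exact hs' (hP hs)

lemma main_sub {N : ℕ} (hN : 1 ≤ N) (k : ℕ) {F : ℍ → ℂ} (hF : GInv N k F)
    (hFx : ∀ g, ∃ p, HX N (sl k F g) p) (R : Subring ℂ) (hRz : zetaC N ∈ R) (hRN : (N : ℂ)⁻¹ ∈ R)
    {p : PowerSeries ℂ} (hp : HX N F p) (h : ∀ n, coeff n p ∈ R) (g : SL(2, ℤ)) {q : PowerSeries ℂ}
    (hq : HX N (sl k F g) q) (n : ℕ) : coeff n q ∈ R := by
  have : NeZero N := ⟨by lia⟩
  obtain ⟨φ, z, hz, hφ⟩ := cyc_emb (N := N)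
  have hO : ∀ x : 𝓞 (CyclotomicField N ℚ), φ x ∈ R := int_mem hz R (hφ ▸ hRz)
  let I : Ideal (𝓞 (CyclotomicField N ℚ)) :=
    { carrier := {s | φ s * coeff n q ∈ R}
      add_mem' := fun {a b} ha hb => by
        simp only [Set.mem_ofPred_eq, map_add, add_mul] at *
        exact add_mem ha hb
      zero_mem' := by simp
      smul_mem' := fun a b hb => by
        simp only [Set.mem_ofPred_eq, smul_eq_mul, map_mul, mul_assoc] at *
        exact mul_mem (hO a) hb }
  obtain ⟨m, hm⟩ := ideal_arg I fun v hv => by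
    let S : AddSubgroup ℂ :=
      { carrier := {x | ∃ s : 𝓞 (CyclotomicField N ℚ), s ∉ v.asIdeal ∧ φ s * x ∈ R}
        add_mem' := by
          rintro x y ⟨s, hs, hx⟩ ⟨t, ht, hy⟩
          refine ⟨s * t, fun hh => (v.isPrime.mem_or_mem hh).elim hs ht, ?_⟩
          have : φ ((s * t : 𝓞 (CyclotomicField N ℚ)) : CyclotomicField N ℚ) * (x + y) =
            φ t * (φ s * x) + φ s * (φ t * y) := by simp only [map_mul]; ring
          rw [this]
          exact add_mem (mul_mem (hO _) hx) (mul_mem (hO _) hy)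
        zero_mem' := ⟨1, fun hh => v.isPrime.ne_top ((Ideal.eq_top_iff_one _).2 hh), by simp⟩
        neg_mem' := by
          rintro x ⟨s, hs, hx⟩
          exact ⟨s, hs, by rw [mul_neg]; exact neg_mem hx⟩ }
    obtain ⟨s, hs, hs'⟩ := Loc.main_all (Λ := mkLoc hz hφ v hv) hN k hF hFx S (by
      rintro _ ⟨b, hb, rfl⟩ x ⟨s, hs, hx⟩
      obtain ⟨a, d, had⟩ := v.exists_primeCompl_mul_eq_of_integer b hb
      refine ⟨s * d, fun hh => (v.isPrime.mem_or_mem hh).elim hs d.2, ?_⟩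
      have : φ ((s * d : 𝓞 (CyclotomicField N ℚ)) : CyclotomicField N ℚ) * (x * φ b) =
        φ (b * algebraMap _ _ (d : 𝓞 (CyclotomicField N ℚ))) * (φ s * x) := by
          simp only [map_mul]; ring
      erw [this, had]
      exact mul_mem (hO _) hx) hp (fun n => ⟨1, fun hh => v.isPrime.ne_top
        ((Ideal.eq_top_iff_one _).2 hh), by simpa using h n⟩) g hq n
    exact ⟨s, hs', hs⟩
  have hm : φ (((N : 𝓞 (CyclotomicField N ℚ)) ^ m : 𝓞 (CyclotomicField N ℚ)) :
    CyclotomicField N ℚ) * coeff n q ∈ R := hm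
  have h2 := mul_mem (pow_mem hRN m) hm
  have hN0 : (N : ℂ) ≠ 0 := NeZero.ne _
  simpa [← mul_assoc, ← mul_pow, hN0] using h2

end QP

namespace QP
open PowerSeries (coeff)
open scoped Manifold

lemma MF_inv {N k : ℕ} (f : ModularForm (CongruenceSubgroup.Gamma N) (k : ℤ)) : GInv N k f := by
  intro γ hγ
  exact f.slash_action_eq' _ ⟨γ, hγ, rfl⟩

lemma MF_exp {N k : ℕ} (hN : 1 ≤ N) (f : ModularForm (CongruenceSubgroup.Gamma N) (k : ℤ))
    (g : SL(2, ℤ)) : ∃ p, HX N (sl k f g) p := by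
  have : NeZero N := ⟨by lia⟩
  refine ⟨qExpansion N (sl k f g), fun τ => ?_⟩
  have hT : sl k (sl k f g) (ModularGroup.T ^ N) = sl k f g := by
    have h1 : g * ModularGroup.T ^ N = (g * ModularGroup.T ^ N * g⁻¹) * g := by group
    rw [sl_comp, h1, ← sl_comp, MF_inv f]
    refine (CongruenceSubgroup.Gamma_normal N).conj_mem _ ?_ g
    rw [CongruenceSubgroup.Gamma_mem]
    simp [ModularGroup.coe_T_zpow, ← zpow_natCast]
  have hper : Function.Periodic (sl k f g ∘ ofComplex) ((N : ℝ) : ℂ) := by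
    intro w
    by_cases! hw : 0 < w.im
    · have h2 : 0 < (w + ((N : ℝ) : ℂ)).im := by simp [hw]
      simp only [Function.comp_apply, ofComplex_apply_of_im_pos h2, ofComplex_apply_of_im_pos hw]
      have h3 := congrFun hT ⟨w, hw⟩
      rw [sl_apply] at h3
      rw [← h3]
      have h4 : ModularGroup.T ^ N • (⟨w, hw⟩ : ℍ) = ⟨w + ((N : ℝ) : ℂ), h2⟩ := by
        ext
        rw [← zpow_natCast, UpperHalfPlane.modular_T_zpow_smul]
        simp [add_comm]
      rw [h4]
      simp [ModularGroup.coe_T_zpow, ← zpow_natCast]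
    · have : (w + ((N : ℝ) : ℂ)).im ≤ 0 := by simpa using hw
      simp only [Function.comp_apply, ofComplex_apply_of_im_nonpos this, ofComplex_apply_of_im_nonpos hw]
  have := hasSum_qExpansion (h := N) (f := sl k f g) (by exact_mod_cast hN) hper
    (by
      have h5 : MDiff (⇑f) := f.holo'
      exact h5.slash _ _)
    (ModularFormClass.bdd_at_infty_slash f g) τ
  simpa [qn_eq] using this

end QP

/-- Let `f` be a modular form of weight `k ≥ 1` on `Γ(N)` and let `A` be
a subring of `ℂ` containing all Fourier coefficients of `f`. Then for every `g ∈ SL₂(ℤ)`,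
all Fourier coefficients of `f|_k g` lie in the subring of `ℂ` generated by `A` together
with `ζ_N` and `1/N`. -/
theorem stmt_18 (N : ℕ) (hN : 1 ≤ N) (k : ℤ) (hk : 1 ≤ k)
    (f : ModularForm (Gamma N) k)
    (A : Subring ℂ)
    (a : ℕ → ℂ) (ha : HasExpansion N (⇑f) a) (haA : ∀ n : ℕ, a n ∈ A) :
    ∀ g : SL(2, ℤ), ∀ c : ℕ → ℂ, HasExpansion N (⇑f ∣[k] g) c →
      ∀ n : ℕ, c n ∈ Subring.closure ((A : Set ℂ) ∪ {zetaC N, ((N : ℂ))⁻¹}) := by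
  intro g c hc n
  lift k to ℕ using by lia
  rw [QP.HX_iff] at ha hc
  have := QP.main_sub hN k (QP.MF_inv f) (QP.MF_exp hN f)
    (Subring.closure ((A : Set ℂ) ∪ {zetaC N, ((N : ℂ))⁻¹}))
    (Subring.subset_closure (by simp)) (Subring.subset_closure (by simp)) ha
    (fun n => Subring.subset_closure (Or.inl (by simpa using haA n))) g hc n
  simpa using this
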